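/- arXiv:1303.3166 — 4 statements merged into one kernel-verified Lean document; each statement's English description precedes it below -/
import Mathlib

section
/- Fix a constant c > 0. There is a constant ε > 0 such that for a random graph G drawn from G(n, 1/2) with n = 2^k, with probability tending to 1 as n → ∞, every resolution refutation of Ψ_G has length at least n^{ε·log₂ n}. -/
open Classical
noncomputable section

/-- A clause: a finite set of literals, where a literal is a pair (variable, polarity). -/
abbrev Clause (V : Type) := Finset (V × Bool)

/-- A literal `(x, b)` is satisfied by assignment `a` iff `a x = b`. -/
def litSat {V : Type} (a : V → Bool) (l : V × Bool) : Prop := a l.1 = l.2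

/-- A clause is satisfied if some literal in it is satisfied. -/
def clauseSat {V : Type} (a : V → Bool) (C : Clause V) : Prop := ∃ l ∈ C, litSat a l

/-- A CNF formula: a set of clauses. -/
abbrev CNF (V : Type) := Set (Clause V)

/-- A CNF is satisfiable if some assignment satisfies all its clauses. -/
def Satisfiable {V : Type} (φ : CNF V) : Prop := ∃ a : V → Bool, ∀ C ∈ φ, clauseSat a C

/-- A resolution refutation of a CNF `φ`: a sequence of clauses, each either a clause of `φ`
or obtained from two earlier clauses `A ∨ x`, `B ∨ ¬x` by the resolution rule (yielding
`A ∨ B`), ending with the empty clause. -/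
structure Refutation {V : Type} [DecidableEq V] (φ : CNF V) where
  clauses : List (Clause V)
  nonempty : clauses ≠ []
  valid : ∀ i : Fin clauses.length, clauses.get i ∈ φ ∨
    ∃ j k : Fin clauses.length, j < i ∧ k < i ∧
      ∃ (x : V) (A B : Clause V),
        clauses.get j = insert (x, true) A ∧
        clauses.get k = insert (x, false) B ∧
        clauses.get i = A ∪ B
  last_empty : clauses.getLast nonempty = ∅

/-- The length of a refutation: the number of clauses in the sequence. -/
def Refutation.length {V : Type} [DecidableEq V] {φ : CNF V} (R : Refutation φ) : ℕ :=
  R.clauses.length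

/-- The width of a refutation: the maximum width (number of literals) of a clause in it. -/
def Refutation.width {V : Type} [DecidableEq V] {φ : CNF V} (R : Refutation φ) : ℕ :=
  (R.clauses.map Finset.card).foldr max 0

/-- `L(φ)`: minimum length of a resolution refutation of `φ` (`⊤` if none exists,
in particular if `φ` is satisfiable). -/
def resLength {V : Type} [DecidableEq V] (φ : CNF V) : ℕ∞ :=
  sInf {l : ℕ∞ | ∃ R : Refutation φ, (R.length : ℕ∞) = l}

/-- `W(φ)`: minimum over refutations of the maximum clause width. -/
def resWidth {V : Type} [DecidableEq V] (φ : CNF V) : ℕ :=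
  sInf {w : ℕ | ∃ R : Refutation φ, R.width = w}

/-- Treelike resolution derivations of a clause from the clauses of `φ`. -/
inductive ResTree {V : Type} [DecidableEq V] (φ : CNF V) : Clause V → Type
  | ax (C : Clause V) (h : C ∈ φ) : ResTree φ C
  | res (x : V) (A B : Clause V) :
      ResTree φ (insert (x, true) A) → ResTree φ (insert (x, false) B) → ResTree φ (A ∪ B)

/-- The length (number of clauses, i.e. nodes) of a treelike derivation. -/
def ResTree.size {V : Type} [DecidableEq V] {φ : CNF V} {C : Clause V} : ResTree φ C → ℕ
  | .ax _ _ => 1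
  | .res _ _ _ t₁ t₂ => t₁.size + t₂.size + 1

/-! ### The Prover–Adversary game -/

/-- A Prover move: query a variable, or erase (forget) a stored value. -/
inductive PMove (V : Type)
  | query (x : V)
  | forget (x : V)

/-- A history of the game: list of moves (most recent first) together with the
Adversary's answer for query moves. -/
abbrev History (V : Type) := List (PMove V × Option Bool)

/-- A Prover strategy: choose the next move given the history so far. -/
def ProverStrat (V : Type) := History V → PMove V

/-- An Adversary strategy: answer a queried variable, given the history so far. -/
def AdvStrat (V : Type) := History V → V → Bool

/-- The stored partial assignment (memory content) determined by a history. -/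
def memOf {V : Type} [DecidableEq V] : History V → V → Option Bool
  | [] => fun _ => none
  | (PMove.query x, ans) :: h => Function.update (memOf h) x ans
  | (PMove.forget x, _) :: h => Function.update (memOf h) x none

/-- The history after `t` rounds of play between strategies `P` and `A`. -/
def play {V : Type} (P : ProverStrat V) (A : AdvStrat V) : ℕ → History V
  | 0 => []
  | t + 1 =>
    let h := play P A t
    match P h with
    | PMove.query x => (PMove.query x, some (A h x)) :: h
    | PMove.forget x => (PMove.forget x, none) :: h

/-- Number of memory locations in use: number of variables with a stored value. -/
def memSize {V : Type} [Fintype V] [DecidableEq V] (h : History V) : ℕ :=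
  (Finset.univ.filter fun x => (memOf h x).isSome).card

/-- The stored partial assignment falsifies clause `C`: every literal of `C` is
assigned and falsified. -/
def falsifies {V : Type} [DecidableEq V] (h : History V) (C : Clause V) : Prop :=
  ∀ l ∈ C, memOf h l.1 = some (!l.2)

/-- The Prover has a strategy winning the game on `φ` while never storing more than `M`
values: against every Adversary, the memory stays within `M` and at some point the
stored partial assignment falsifies a clause of `φ`. -/
def ProverWinsWith {V : Type} [Fintype V] [DecidableEq V] (φ : CNF V) (M : ℝ) : Prop :=
  ∃ P : ProverStrat V, ∀ A : AdvStrat V,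
    (∀ t, (memSize (play P A t) : ℝ) ≤ M) ∧ ∃ t, ∃ C ∈ φ, falsifies (play P A t) C

/-- The Adversary has a strategy winning against every Prover who uses at most `M`
memory locations: whenever the play keeps the memory within `M`, no clause of `φ` is
ever falsified. -/
def AdversaryWinsAgainst {V : Type} [Fintype V] [DecidableEq V] (φ : CNF V) (M : ℝ) : Prop :=
  ∃ A : AdvStrat V, ∀ P : ProverStrat V,
    (∀ t, (memSize (play P A t) : ℝ) ≤ M) → ∀ t, ∀ C ∈ φ, ¬ falsifies (play P A t) C

/-! ### Ramsey graphs and the formulas `Ψ_G`, `Clique(G)` -/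

/-- A graph on `n` vertices is `c`-Ramsey if no set of `c·log₂ n` vertices forms a clique
or an independent set. -/
def IsCRamsey (c : ℝ) {n : ℕ} (G : SimpleGraph (Fin n)) : Prop :=
  ¬ ∃ T : Finset (Fin n), T.card = ⌈c * Real.logb 2 n⌉₊ ∧
      (G.IsClique (T : Set (Fin n)) ∨ Gᶜ.IsClique (T : Set (Fin n)))

/-- The number `ck` of indices. -/
def numIdx (c : ℝ) (k : ℕ) : ℕ := ⌈c * (k : ℕ)⌉₊

/-- Variables of the formula `Clique(G)`: bit `b` of the vertex assigned to index `i`. -/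
abbrev CliqueVar (c : ℝ) (k : ℕ) := Fin (numIdx c k) × Fin k

/-- Variables of `Ψ_G`: the bit variables `x^i_b` together with the extra variable `y`. -/
abbrev PsiVar (c : ℝ) (k : ℕ) := CliqueVar c k ⊕ Unit

/-- Bit `b` of the binary representation of vertex `v`. -/
def vbit {k : ℕ} (v : Fin (2 ^ k)) (b : Fin k) : Bool := Nat.testBit v.val b.val

/-- The clause `⋁_b (x^i_b ≠ v_b)`, saying that index `i` is not mapped to vertex `v`. -/
def neqClause (c : ℝ) (k : ℕ) (i : Fin (numIdx c k)) (v : Fin (2 ^ k)) :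
    Clause (CliqueVar c k) :=
  Finset.univ.image fun b : Fin k => (((i, b) : CliqueVar c k), ! vbit v b)

/-- The CNF `Clique(G)`: injectivity clauses, plus for each non-edge `{u,v}` and distinct
indices `i,j` the clause `⋁_b (x^i_b ≠ u_b) ∨ ⋁_b (x^j_b ≠ v_b)`.  It is satisfiable iff
`G` has a clique of size `ck`. -/
def CliqueCNF (c : ℝ) {k : ℕ} (G : SimpleGraph (Fin (2 ^ k))) : CNF (CliqueVar c k) :=
  {C | (∃ i j : Fin (numIdx c k), i ≠ j ∧ ∃ v : Fin (2 ^ k),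
          C = neqClause c k i v ∪ neqClause c k j v) ∨
       (∃ i j : Fin (numIdx c k), i ≠ j ∧ ∃ u v : Fin (2 ^ k), u ≠ v ∧ ¬ G.Adj u v ∧
          C = neqClause c k i u ∪ neqClause c k j v)}

/-- Lift a clause on the bit variables to the variable set of `Ψ_G`. -/
def liftClause {c : ℝ} {k : ℕ} (C : Clause (CliqueVar c k)) : Clause (PsiVar c k) :=
  C.image fun l => (Sum.inl l.1, l.2)

/-- The CNF `Ψ_G`: (1) injectivity clauses; (2) for each edge `{u,v}` and distinct `i,j`
the clause `y ∨ ⋁_b (x^i_b ≠ u_b) ∨ ⋁_b (x^j_b ≠ v_b)`; (3) for each non-edge `{u,v}` and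
distinct `i,j` the clause `¬y ∨ ⋁_b (x^i_b ≠ u_b) ∨ ⋁_b (x^j_b ≠ v_b)`. -/
def PsiCNF (c : ℝ) {k : ℕ} (G : SimpleGraph (Fin (2 ^ k))) : CNF (PsiVar c k) :=
  {C | (∃ i j : Fin (numIdx c k), i ≠ j ∧ ∃ v : Fin (2 ^ k),
          C = liftClause (neqClause c k i v ∪ neqClause c k j v)) ∨
       (∃ i j : Fin (numIdx c k), i ≠ j ∧ ∃ u v : Fin (2 ^ k), G.Adj u v ∧
          C = insert (Sum.inr (), true)
                (liftClause (neqClause c k i u ∪ neqClause c k j v))) ∨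
       (∃ i j : Fin (numIdx c k), i ≠ j ∧ ∃ u v : Fin (2 ^ k), u ≠ v ∧ ¬ G.Adj u v ∧
          C = insert (Sum.inr (), false)
                (liftClause (neqClause c k i u ∪ neqClause c k j v)))}

/-! ### Property P, density, probability -/

/-- Property P: for every `U ⊆ V(G)` with `|U| ≤ k/3` and every pattern `p` with
`|p| ≤ k/3`, some common neighbour of `U` is consistent with `p`.  A pattern is a partial
assignment `p : Fin k → Option Bool` of the `k` bits; its size is the number of assigned
bits. -/
def PropertyP {k : ℕ} (G : SimpleGraph (Fin (2 ^ k))) : Prop :=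
  ∀ U : Finset (Fin (2 ^ k)), 3 * U.card ≤ k →
    ∀ p : Fin k → Option Bool, 3 * (Finset.univ.filter fun b => (p b).isSome).card ≤ k →
      ∃ v : Fin (2 ^ k), (∀ u ∈ U, G.Adj u v) ∧
        ∀ (b : Fin k) (bit : Bool), p b = some bit → vbit v b = bit

/-- The mutual density `d(A,B) = e(A,B)/(|A|·|B|)`, where `e(A,B)` is the number of pairs
`(a,b) ∈ A × B` with `{a,b}` an edge. -/
def density {α : Type} (G : SimpleGraph α) (A B : Finset α) : ℝ :=
  (((A ×ˢ B).filter fun ab => G.Adj ab.1 ab.2).card : ℝ) / ((A.card : ℝ) * (B.card : ℝ))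

/-- The probability of the event `P` under the uniform distribution on a finite type;
the uniform distribution on `SimpleGraph (Fin n)` is exactly `G(n, 1/2)`. -/
def probOf {α : Type} [Fintype α] (P : α → Prop) : ℝ :=
  ((Finset.univ.filter P).card : ℝ) / (Fintype.card α : ℝ)

/-! ### The unary formula `Ψ'_G` -/

/-- Variables of the unary formula `Ψ'_G`: variables `p^i_v` for `i ∈ [c·log₂ n]`,
`v ∈ V(G)`, plus the extra variable `y`. -/
abbrev UnaryVar (c : ℝ) (n : ℕ) := (Fin ⌈c * Real.logb 2 n⌉₊ × Fin n) ⊕ Unit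

/-- The unary CNF `Ψ'_G`: each index is mapped to exactly one vertex, the map is
injective, and (depending on `y`) the image is a clique or an independent set. -/
def PsiUnary (c : ℝ) {n : ℕ} (G : SimpleGraph (Fin n)) : CNF (UnaryVar c n) :=
  {C | (∃ i : Fin ⌈c * Real.logb 2 n⌉₊,
          C = Finset.univ.image fun v : Fin n => ((Sum.inl (i, v) : UnaryVar c n), true)) ∨
       (∃ i : Fin ⌈c * Real.logb 2 n⌉₊, ∃ u v : Fin n, u ≠ v ∧
          C = {((Sum.inl (i, u) : UnaryVar c n), false), (Sum.inl (i, v), false)}) ∨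
       (∃ i j : Fin ⌈c * Real.logb 2 n⌉₊, i ≠ j ∧ ∃ v : Fin n,
          C = {((Sum.inl (i, v) : UnaryVar c n), false), (Sum.inl (j, v), false)}) ∨
       (∃ i j : Fin ⌈c * Real.logb 2 n⌉₊, i ≠ j ∧ ∃ u v : Fin n, G.Adj u v ∧
          C = {((Sum.inr () : UnaryVar c n), true), (Sum.inl (i, u), false),
               (Sum.inl (j, v), false)}) ∨
       (∃ i j : Fin ⌈c * Real.logb 2 n⌉₊, i ≠ j ∧ ∃ u v : Fin n, u ≠ v ∧ ¬ G.Adj u v ∧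
          C = {((Sum.inr () : UnaryVar c n), false), (Sum.inl (i, u), false),
               (Sum.inl (j, v), false)})}

end

/-- Bits of index `i` mentioned by the clause. -/
noncomputable def mentionBits {c : ℝ} {k : ℕ} (C : Clause (PsiVar c k)) (i : Fin (numIdx c k)) :
    Finset (Fin k) :=
  Finset.univ.filter fun b => ∃ β, ((Sum.inl (i, b) : PsiVar c k), β) ∈ C

/-- Indices mentioned heavily by the clause. -/
noncomputable def heavyIdx {c : ℝ} {k : ℕ} (q : ℕ) (C : Clause (PsiVar c k)) :
    Finset (Fin (numIdx c k)) :=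
  Finset.univ.filter fun i => 2 * q < (mentionBits C i).card

/-- Total assignment from a map of indices to vertices, with `y = true`. -/
def asgOf {c : ℝ} {k : ℕ} (a : Fin (numIdx c k) → Fin (2 ^ k)) : PsiVar c k → Bool
  | Sum.inl x => vbit (a x.1) x.2
  | Sum.inr _ => true

/-- The extension property used by the adversary. -/
def ExtProp {k : ℕ} (q : ℕ) (G : SimpleGraph (Fin (2 ^ k))) : Prop :=
  ∀ U : Finset (Fin (2 ^ k)), U.card ≤ 2 * q →
    ∀ p : Fin k → Option Bool, (Finset.univ.filter fun b => (p b).isSome).card ≤ 3 * q →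
      ∃ v : Fin (2 ^ k), (∀ u ∈ U, G.Adj u v) ∧
        ∀ (b : Fin k) (bit : Bool), p b = some bit → vbit v b = bit

theorem vbit_inj {k : ℕ} {u v : Fin (2 ^ k)} (h : ∀ b, vbit u b = vbit v b) : u = v := by
  apply Fin.ext
  apply Nat.eq_of_testBit_eq
  intro i
  by_cases hi : i < k
  · exact h ⟨i, hi⟩
  · have hle : 2 ^ k ≤ 2 ^ i := Nat.pow_le_pow_right (by norm_num) (by omega)
    rw [Nat.testBit_lt_two_pow (lt_of_lt_of_le u.2 hle),
      Nat.testBit_lt_two_pow (lt_of_lt_of_le v.2 hle)]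

theorem mentionBits_mono {c : ℝ} {k : ℕ} {C D : Clause (PsiVar c k)} {i : Fin (numIdx c k)}
    (h : ∀ b β, ((Sum.inl (i, b) : PsiVar c k), β) ∈ C → ((Sum.inl (i, b) : PsiVar c k), β) ∈ D) :
    mentionBits C i ⊆ mentionBits D i := by
  intro b hb
  simp only [mentionBits, Finset.mem_filter, Finset.mem_univ, true_and] at hb ⊢
  obtain ⟨β, hβ⟩ := hb
  exact ⟨β, h b β hβ⟩

theorem heavy_mono {c : ℝ} {k q : ℕ} {C D : Clause (PsiVar c k)} {i : Fin (numIdx c k)}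
    (h : ∀ b β, ((Sum.inl (i, b) : PsiVar c k), β) ∈ C → ((Sum.inl (i, b) : PsiVar c k), β) ∈ D)
    (hi : i ∈ heavyIdx q C) : i ∈ heavyIdx q D := by
  simp only [heavyIdx, Finset.mem_filter, Finset.mem_univ, true_and] at hi ⊢
  exact lt_of_lt_of_le hi (Finset.card_le_card (mentionBits_mono h))

/-- The adversary's invariant. -/
def GoodPos {c : ℝ} {k : ℕ} (q : ℕ) (G : SimpleGraph (Fin (2 ^ k)))
    (ρ : CliqueVar c k → Option Bool) (C : Clause (PsiVar c k)) : Prop :=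
  ∃ a : Fin (numIdx c k) → Fin (2 ^ k),
    (∀ x β, ρ x = some β → vbit (a x.1) x.2 = β) ∧
    (∀ l ∈ C, asgOf a l.1 ≠ l.2) ∧
    (∀ i ∈ heavyIdx q C, ∀ j ∈ heavyIdx q C, i ≠ j → G.Adj (a i) (a j))

theorem neq_falsified {c : ℝ} {k q : ℕ} (hk : 2 * q < k) (a : Fin (numIdx c k) → Fin (2 ^ k))
    (C : Clause (PsiVar c k)) (hC : ∀ l ∈ C, asgOf a l.1 ≠ l.2)
    (i : Fin (numIdx c k)) (u : Fin (2 ^ k))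
    (h : ∀ l ∈ neqClause c k i u, ((Sum.inl l.1 : PsiVar c k), l.2) ∈ C) :
    a i = u ∧ i ∈ heavyIdx q C := by
  have hm : ∀ b : Fin k, ((Sum.inl (i, b) : PsiVar c k), ! vbit u b) ∈ C := by
    intro b
    exact h ((i, b), ! vbit u b) (Finset.mem_image.2 ⟨b, Finset.mem_univ _, rfl⟩)
  constructor
  · apply vbit_inj
    intro b
    have := hC _ (hm b)
    simpa [asgOf] using this
  · simp only [heavyIdx, Finset.mem_filter, Finset.mem_univ, true_and]
    have : mentionBits C i = Finset.univ := by
      ext b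
      simp only [mentionBits, Finset.mem_filter, Finset.mem_univ, true_and, iff_true]
      exact ⟨_, hm b⟩
    rw [this]; simpa using hk

theorem initial_notGood {c : ℝ} {k q : ℕ} (hk : 2 * q < k) (G : SimpleGraph (Fin (2 ^ k)))
    (ρ : CliqueVar c k → Option Bool) (C : Clause (PsiVar c k)) (hC : C ∈ PsiCNF c G) :
    ¬ GoodPos q G ρ C := by
  rintro ⟨a, -, hf, hadj⟩
  rcases hC with ⟨i, j, hij, v, rfl⟩ | ⟨i, j, hij, u, v, huv, rfl⟩ | ⟨i, j, hij, u, v, huv, hn, rfl⟩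
  · obtain ⟨h1, h2⟩ := neq_falsified hk a _ hf i v (fun l hl => by
      apply Finset.mem_image.2; exact ⟨l, Finset.mem_union_left _ hl, rfl⟩)
    obtain ⟨h3, h4⟩ := neq_falsified hk a _ hf j v (fun l hl => by
      apply Finset.mem_image.2; exact ⟨l, Finset.mem_union_right _ hl, rfl⟩)
    have := hadj i h2 j h4 hij
    rw [h1, h3] at this
    exact G.loopless.irrefl _ this
  · have := hf (Sum.inr (), true) (Finset.mem_insert_self _ _)
    simp [asgOf] at this
  · obtain ⟨h1, h2⟩ := neq_falsified hk a _ hf i u (fun l hl => by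
      apply Finset.mem_insert_of_mem
      apply Finset.mem_image.2; exact ⟨l, Finset.mem_union_left _ hl, rfl⟩)
    obtain ⟨h3, h4⟩ := neq_falsified hk a _ hf j v (fun l hl => by
      apply Finset.mem_insert_of_mem
      apply Finset.mem_image.2; exact ⟨l, Finset.mem_union_right _ hl, rfl⟩)
    have := hadj i h2 j h4 hij
    rw [h1, h3] at this
    exact hn this

theorem good_step {c : ℝ} {k q : ℕ} (G : SimpleGraph (Fin (2 ^ k)))
    (hQ : ExtProp q G) (ρ : CliqueVar c k → Option Bool)
    (hρ : ∀ i, (Finset.univ.filter fun b => (ρ (i, b)).isSome).card ≤ q)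
    (C C₁ C₂ : Clause (PsiVar c k)) (x : PsiVar c k)
    (h1 : ∀ l ∈ C₁, l = (x, true) ∨ l ∈ C) (h2 : ∀ l ∈ C₂, l = (x, false) ∨ l ∈ C)
    (hnar : (∃ x β, ρ x = some β ∧ ((Sum.inl x : PsiVar c k), β) ∈ C) ∨ (heavyIdx q C).card ≤ 2 * q)
    (hg : GoodPos q G ρ C) : GoodPos q G ρ C₁ ∨ GoodPos q G ρ C₂ := by
  obtain ⟨a, ha1, ha2, ha3⟩ := hg
  have hnar : (heavyIdx q C).card ≤ 2 * q := by
    rcases hnar with ⟨x, β, hx, hl⟩ | h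
    · exact absurd (ha1 x β hx) (ha2 _ hl)
    · exact h
  -- it suffices to find a suitable assignment
  suffices H : ∃ a' : Fin (numIdx c k) → Fin (2 ^ k),
      (∀ x β, ρ x = some β → vbit (a' x.1) x.2 = β) ∧ (∀ l ∈ C, asgOf a' l.1 ≠ l.2) ∧
      (∀ i j, (i ∈ heavyIdx q C ∨ ∃ b, x = Sum.inl (i, b)) →
        (j ∈ heavyIdx q C ∨ ∃ b, x = Sum.inl (j, b)) → i ≠ j → G.Adj (a' i) (a' j)) by
    obtain ⟨a', hb1, hb2, hb3⟩ := H
    have key : ∀ (D : Clause (PsiVar c k)) (s : Bool), asgOf a' x ≠ s →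
        (∀ l ∈ D, l = (x, s) ∨ l ∈ C) → GoodPos q G ρ D := by
      intro D s hs hD
      have hh : ∀ i ∈ heavyIdx q D, (i ∈ heavyIdx q C ∨ ∃ b, x = Sum.inl (i, b)) := by
        intro i hi
        by_cases hx : ∃ b, x = Sum.inl (i, b)
        · exact Or.inr hx
        · left
          refine heavy_mono ?_ hi
          intro b β hb
          rcases hD _ hb with h | h
          · exact absurd ⟨b, (congrArg Prod.fst h).symm⟩ hx
          · exact h
      refine ⟨a', hb1, ?_, ?_⟩
      · intro l hl
        rcases hD l hl with rfl | h
        · exact hs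
        · exact hb2 l h
      · intro i hi j hj hij
        exact hb3 i j (hh i hi) (hh j hj) hij
    cases hv : asgOf a' x
    · left; exact key C₁ true (by simp [hv]) h1
    · right; exact key C₂ false (by simp [hv]) h2
  rcases x with ⟨i, b⟩ | y
  · by_cases hi : i ∈ heavyIdx q C
    · refine ⟨a, ha1, ha2, ?_⟩
      have hh : ∀ i', (i' ∈ heavyIdx q C ∨ ∃ b', (Sum.inl (i, b) : PsiVar c k) = Sum.inl (i', b')) →
          i' ∈ heavyIdx q C := by
        rintro i' (h | ⟨b', h⟩)
        · exact h
        · have : i = i' := congrArg Prod.fst (Sum.inl.inj h)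
          exact this ▸ hi
      intro i₁ j₁ hi₁ hj₁ hne
      exact ha3 _ (hh _ hi₁) _ (hh _ hj₁) hne
    · have hmc : (mentionBits C i).card ≤ 2 * q := by
        simp only [heavyIdx, Finset.mem_filter, Finset.mem_univ, true_and] at hi
        omega
      obtain ⟨v, hv1, hv2⟩ := hQ ((heavyIdx q C).image a)
        (le_trans Finset.card_image_le hnar)
        (fun b => if b ∈ mentionBits C i ∨ (ρ (i, b)).isSome then some (vbit (a i) b) else none)
        (by
          have : (Finset.univ.filter fun b => (if b ∈ mentionBits C i ∨ (ρ (i, b)).isSome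
              then some (vbit (a i) b) else none).isSome) ⊆
              mentionBits C i ∪ (Finset.univ.filter fun b => (ρ (i, b)).isSome) := by
            intro b hb
            simp only [Finset.mem_filter, Finset.mem_univ, true_and] at hb
            by_cases hc : b ∈ mentionBits C i ∨ (ρ (i, b)).isSome
            · rcases hc with h | h
              · exact Finset.mem_union_left _ h
              · exact Finset.mem_union_right _ (by simpa using h)
            · rw [if_neg hc] at hb; simp at hb
          have h3 := Finset.card_le_card this
          have h4 := Finset.card_union_le (mentionBits C i)
            (Finset.univ.filter fun b => (ρ (i, b)).isSome)
          have h5 := hρ i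
          omega)
      have hv2' : ∀ b, (b ∈ mentionBits C i ∨ (ρ (i, b)).isSome) → vbit v b = vbit (a i) b := by
        intro b hb
        exact hv2 b _ (by simp [hb])
      refine ⟨Function.update a i v, ?_, ?_, ?_⟩
      · rintro ⟨i', b'⟩ β hβ
        by_cases h : i' = i
        · subst h
          simp only [Function.update_self]
          rw [hv2' b' (Or.inr (by simp [hβ]))]
          exact ha1 _ _ hβ
        · simp only [Function.update_of_ne h]
          exact ha1 _ _ hβ
      · rintro ⟨⟨i', b'⟩ | y, β⟩ hl
        · have h0 := ha2 _ hl
          by_cases h : i' = i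
          · subst h
            simp only [asgOf, Function.update_self] at h0 ⊢
            rw [hv2' b' (Or.inl (by simp [mentionBits]; rcases β with _ | _ <;> simp [hl]))]
            exact h0
          · simp only [asgOf, Function.update_of_ne h] at h0 ⊢
            exact h0
        · exact ha2 _ hl
      · have hh : ∀ i', (i' ∈ heavyIdx q C ∨
            ∃ b', (Sum.inl (i, b) : PsiVar c k) = Sum.inl (i', b')) →
            i' ∈ heavyIdx q C ∨ i' = i := by
          rintro i' (h | ⟨b', h⟩)
          · exact Or.inl h
          · exact Or.inr (congrArg Prod.fst (Sum.inl.inj h)).symm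
        intro i₁ j₁ hi₁ hj₁ hne
        by_cases e1 : i₁ = i
        · subst e1
          have hj : j₁ ∈ heavyIdx q C := (hh _ hj₁).resolve_right (Ne.symm hne)
          rw [Function.update_self, Function.update_of_ne (Ne.symm hne)]
          exact (hv1 _ (Finset.mem_image_of_mem _ hj)).symm
        · have hi' := (hh _ hi₁).resolve_right e1
          rw [Function.update_of_ne e1]
          by_cases e2 : j₁ = i
          · subst e2
            rw [Function.update_self]
            exact hv1 _ (Finset.mem_image_of_mem _ hi')
          · rw [Function.update_of_ne e2]
            exact ha3 _ hi' _ ((hh _ hj₁).resolve_right e2) hne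
  · refine ⟨a, ha1, ha2, ?_⟩
    intro i₁ j₁ hi₁ hj₁ hne
    exact ha3 _ (hi₁.resolve_right (by simp)) _ (hj₁.resolve_right (by simp)) hne

theorem no_narrow {c : ℝ} {k q : ℕ} (hk : 2 * q < k) (G : SimpleGraph (Fin (2 ^ k)))
    (hQ : ExtProp q G) (ρ : CliqueVar c k → Option Bool)
    (hρ : ∀ i, (Finset.univ.filter fun b => (ρ (i, b)).isSome).card ≤ q)
    (R : Refutation (PsiCNF c G))
    (hR : ∀ C ∈ R.clauses, (∃ x β, ρ x = some β ∧ ((Sum.inl x : PsiVar c k), β) ∈ C) ∨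
      (heavyIdx q C).card ≤ 2 * q) : False := by
  have key : ∀ (n : ℕ) (h : n < R.clauses.length), ¬ GoodPos q G ρ (R.clauses.get ⟨n, h⟩) := by
    intro n
    induction n using Nat.strong_induction_on with
    | _ n ih =>
      intro h hg
      rcases R.valid ⟨n, h⟩ with hax | ⟨j, l, hj, hl, x, A, B, hA, hB, hAB⟩
      · exact initial_notGood hk G ρ _ hax hg
      · rcases good_step G hQ ρ hρ _ (R.clauses.get j) (R.clauses.get l) x
          (by
            intro m hm
            rw [hA, Finset.mem_insert] at hm
            rw [hAB]
            exact hm.imp id (fun h => Finset.mem_union_left _ h))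
          (by
            intro m hm
            rw [hB, Finset.mem_insert] at hm
            rw [hAB]
            exact hm.imp id (fun h => Finset.mem_union_right _ h))
          (hR _ (List.get_mem _ _)) hg with h' | h'
        · exact ih j.1 hj j.2 h'
        · exact ih l.1 hl l.2 h'
  have hpos : 0 < R.clauses.length := List.length_pos_iff.2 R.nonempty
  apply key (R.clauses.length - 1) (by omega)
  have hlast : R.clauses.get ⟨R.clauses.length - 1, by omega⟩ = ∅ := by
    rw [← R.last_empty, List.getLast_eq_getElem]; rfl
  rw [hlast]
  have hpick : ∀ i : Fin (numIdx c k), ∃ v : Fin (2 ^ k),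
      ∀ (b : Fin k) (bit : Bool), ρ (i, b) = some bit → vbit v b = bit := by
    intro i
    obtain ⟨v, -, hv⟩ := hQ ∅ (by simp) (fun b => ρ (i, b)) (le_trans (hρ i) (by omega))
    exact ⟨v, hv⟩
  choose a ha using hpick
  refine ⟨a, fun x β h => ha x.1 x.2 β h, by simp, ?_⟩
  intro i hi
  simp [heavyIdx, mentionBits] at hi

/-- number of literals on bit variables available -/
theorem wide_avail {c : ℝ} {k q : ℕ} (ρ : CliqueVar c k → Option Bool)
    (hρ : ∀ i, (Finset.univ.filter fun b => (ρ (i, b)).isSome).card ≤ q)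
    (htot : (Finset.univ.filter fun x : CliqueVar c k => (ρ x).isSome).card < q ^ 2)
    (C : Clause (PsiVar c k)) (hC : 2 * q < (heavyIdx q C).card) :
    q ^ 2 ≤ (Finset.univ.filter fun l : CliqueVar c k × Bool =>
      (ρ l.1 = none ∧ (Finset.univ.filter fun b => (ρ (l.1.1, b)).isSome).card < q) ∧
        ((Sum.inl l.1 : PsiVar c k), l.2) ∈ C).card := by
  set E : Finset (Fin (numIdx c k)) := Finset.univ.filter fun i =>
    ¬ (Finset.univ.filter fun b => (ρ (i, b)).isSome).card < q with hE
  have hEq : E.card * q < q ^ 2 := by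
    refine lt_of_le_of_lt ?_ htot
    have h1 : (Finset.univ.filter fun x : CliqueVar c k => (ρ x).isSome ∧ x.1 ∈ E).card =
        ∑ i ∈ E, ((Finset.univ.filter fun x : CliqueVar c k => (ρ x).isSome ∧ x.1 ∈ E).filter
          fun x => x.1 = i).card :=
      Finset.card_eq_sum_card_fiberwise (f := Prod.fst) (by
        intro x hx
        simp only [Finset.coe_filter, Finset.mem_univ, true_and, Set.mem_ofPred_eq] at hx
        exact hx.2)
    have h2 : (Finset.univ.filter fun x : CliqueVar c k => (ρ x).isSome ∧ x.1 ∈ E).card ≤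
        (Finset.univ.filter fun x : CliqueVar c k => (ρ x).isSome).card := by
      apply Finset.card_le_card
      intro x hx
      simp only [Finset.mem_filter, Finset.mem_univ, true_and] at hx ⊢
      exact hx.1
    refine le_trans ?_ h2
    rw [h1, ← smul_eq_mul]
    apply Finset.card_nsmul_le_sum
    intro i hi
    have hi' := hi
    simp only [hE, Finset.mem_filter, Finset.mem_univ, true_and, not_lt] at hi'
    refine le_trans hi' ?_
    rw [← Finset.card_image_of_injective _ (Prod.mk_right_injective i)]
    apply Finset.card_le_card
    intro x hx
    simp only [Finset.mem_image, Finset.mem_filter, Finset.mem_univ, true_and] at hx ⊢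
    obtain ⟨b, hb, rfl⟩ := hx
    exact ⟨⟨hb, hi⟩, rfl⟩
  have hEc : E.card < q := by
    by_contra h
    push Not at h
    have : q * q ≤ E.card * q := Nat.mul_le_mul_right _ h
    rw [sq] at hEq
    omega
  set H := heavyIdx q C \ E with hH
  have hHc : q ≤ H.card := by
    have h0 : (heavyIdx q C).card - E.card ≤ H.card := Finset.le_card_sdiff E (heavyIdx q C)
    omega
  set P : Finset (CliqueVar c k) := Finset.univ.filter fun x =>
    x.1 ∈ H ∧ x.2 ∈ mentionBits C x.1 ∧ ρ x = none with hP
  have hPc : q ^ 2 ≤ P.card := by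
    have h1 : P.card = ∑ i ∈ H, (P.filter fun x => x.1 = i).card :=
      Finset.card_eq_sum_card_fiberwise (f := Prod.fst) (by
        intro x hx
        simp only [hP, Finset.coe_filter, Finset.mem_univ, true_and, Set.mem_ofPred_eq] at hx
        exact hx.1)
    rw [h1]
    have h2 : H.card • q ≤ ∑ i ∈ H, (P.filter fun x => x.1 = i).card := by
      apply Finset.card_nsmul_le_sum
      intro i hi
      have hm : 2 * q < (mentionBits C i).card := by
        have := (Finset.mem_sdiff.1 hi).1
        simpa only [heavyIdx, Finset.mem_filter, Finset.mem_univ, true_and] using this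
      have h3 : q ≤ (mentionBits C i \ (Finset.univ.filter fun b => (ρ (i, b)).isSome)).card := by
        have := Finset.le_card_sdiff (Finset.univ.filter fun b => (ρ (i, b)).isSome)
          (mentionBits C i)
        have := hρ i
        omega
      refine le_trans h3 ?_
      rw [← Finset.card_image_of_injective _ (Prod.mk_right_injective i)]
      apply Finset.card_le_card
      intro x hx
      simp only [Finset.mem_image, Finset.mem_sdiff, Finset.mem_filter, Finset.mem_univ,
        true_and] at hx
      obtain ⟨b, hb, rfl⟩ := hx
      simp only [hP, Finset.mem_filter, Finset.mem_univ, true_and, and_true]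
      refine ⟨hi, hb.1, ?_⟩
      simpa using hb.2
    refine le_trans ?_ h2
    rw [smul_eq_mul, sq]
    exact Nat.mul_le_mul_right _ hHc
  refine le_trans hPc ?_
  refine le_trans ?_ (Finset.card_image_le (f := Prod.fst))
  apply Finset.card_le_card
  intro x hx
  simp only [hP, Finset.mem_filter, Finset.mem_univ, true_and] at hx
  obtain ⟨h1, h2, h3⟩ := hx
  simp only [mentionBits, Finset.mem_filter, Finset.mem_univ, true_and] at h2
  obtain ⟨β, hβ⟩ := h2
  have h4 : x.1 ∉ E := (Finset.mem_sdiff.1 h1).2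
  simp only [hE, Finset.mem_filter, Finset.mem_univ, true_and, not_not] at h4
  refine Finset.mem_image.2 ⟨(x, β), ?_, rfl⟩
  simp only [Finset.mem_filter, Finset.mem_univ, true_and]
  exact ⟨⟨h3, h4⟩, hβ⟩

theorem greedy_pick {c : ℝ} {k q : ℕ} (hq : 0 < q) (ρ : CliqueVar c k → Option Bool)
    (hρ : ∀ i, (Finset.univ.filter fun b => (ρ (i, b)).isSome).card ≤ q)
    (htot : (Finset.univ.filter fun x : CliqueVar c k => (ρ x).isSome).card < q ^ 2)
    (F : Finset (Clause (PsiVar c k))) (hF : F.Nonempty)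
    (hC : ∀ C ∈ F, 2 * q < (heavyIdx q C).card) :
    ∃ (x : CliqueVar c k) (β : Bool), ρ x = none ∧
      (Finset.univ.filter fun b => (ρ (x.1, b)).isSome).card < q ∧
      F.card * q ^ 2 ≤ (F.filter fun C => ((Sum.inl x : PsiVar c k), β) ∈ C).card *
        (2 * (numIdx c k * k)) := by
  set Av : Finset (CliqueVar c k × Bool) := Finset.univ.filter fun l =>
    ρ l.1 = none ∧ (Finset.univ.filter fun b => (ρ (l.1.1, b)).isSome).card < q with hAv
  by_contra hcon
  push Not at hcon
  have hdc : ∑ C ∈ F, (Av.filter fun l => ((Sum.inl l.1 : PsiVar c k), l.2) ∈ C).card =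
      ∑ l ∈ Av, (F.filter fun C => ((Sum.inl l.1 : PsiVar c k), l.2) ∈ C).card := by
    simp only [Finset.card_filter]
    exact Finset.sum_comm
  have hlow : ∀ C ∈ F, q ^ 2 ≤
      (Av.filter fun l => ((Sum.inl l.1 : PsiVar c k), l.2) ∈ C).card := by
    intro C hCF
    rw [hAv, Finset.filter_filter]
    exact wide_avail ρ hρ htot C (hC C hCF)
  have hsum : F.card * q ^ 2 ≤
      ∑ l ∈ Av, (F.filter fun C => ((Sum.inl l.1 : PsiVar c k), l.2) ∈ C).card := by
    rw [← hdc, ← smul_eq_mul]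
    exact Finset.card_nsmul_le_sum _ _ _ hlow
  have hAvne : Av.Nonempty := by
    obtain ⟨C, hCF⟩ := hF
    have h1 := hlow C hCF
    have h2 : 0 < q ^ 2 := by positivity
    obtain ⟨l, hl⟩ := Finset.card_pos.1 (lt_of_lt_of_le h2 h1)
    exact ⟨l, (Finset.mem_filter.1 hl).1⟩
  have hAvc : Av.card ≤ 2 * (numIdx c k * k) := by
    refine le_trans (Finset.card_le_univ _) ?_
    simp [Fintype.card_prod]
    omega
  have hlt : ∑ l ∈ Av, (F.filter fun C => ((Sum.inl l.1 : PsiVar c k), l.2) ∈ C).card *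
        (2 * (numIdx c k * k)) < ∑ l ∈ Av, F.card * q ^ 2 := by
    apply Finset.sum_lt_sum_of_nonempty hAvne
    intro l hl
    simp only [hAv, Finset.mem_filter, Finset.mem_univ, true_and] at hl
    exact hcon l.1 l.2 hl.1 hl.2
  rw [← Finset.sum_mul, Finset.sum_const, smul_eq_mul] at hlt
  have h5 : Av.card * (F.card * q ^ 2) ≤ (2 * (numIdx c k * k)) * (F.card * q ^ 2) :=
    Nat.mul_le_mul_right _ hAvc
  have h6 := Nat.mul_le_mul_right (2 * (numIdx c k * k)) hsum
  rw [mul_comm (2 * (numIdx c k * k)) (F.card * q ^ 2)] at h5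
  omega

theorem greedy {c : ℝ} {k q : ℕ} (hq : 0 < q)
    (W : Finset (Clause (PsiVar c k)))
    (hC : ∀ C ∈ W, 2 * q < (heavyIdx q C).card) (t : ℕ) (ht : t ≤ q ^ 2) :
    ∃ ρ : CliqueVar c k → Option Bool,
      (∀ i, (Finset.univ.filter fun b => (ρ (i, b)).isSome).card ≤ q) ∧
      (Finset.univ.filter fun x : CliqueVar c k => (ρ x).isSome).card ≤ t ∧
      ((W.filter fun C => ¬ ∃ x β, ρ x = some β ∧ ((Sum.inl x : PsiVar c k), β) ∈ C).card : ℝ) ≤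
        W.card * Real.exp (- (t * ((q : ℝ) ^ 2 / (2 * (numIdx c k * k))))) := by
  induction t with
  | zero =>
    refine ⟨fun _ => none, by simp, by simp, ?_⟩
    simp
  | succ t ih =>
    obtain ⟨ρ, h1, h2, h3⟩ := ih (by omega)
    set F := W.filter fun C => ¬ ∃ x β, ρ x = some β ∧ ((Sum.inl x : PsiVar c k), β) ∈ C with hFdef
    by_cases hF : F.Nonempty
    swap
    · refine ⟨ρ, h1, by omega, ?_⟩
      rw [← hFdef, Finset.not_nonempty_iff_eq_empty.1 hF]
      simp only [Finset.card_empty, Nat.cast_zero]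
      positivity
    obtain ⟨x, β, hx, hxc, hcard⟩ := greedy_pick hq ρ h1 (by omega) F hF
      (fun C h => hC C (Finset.mem_filter.1 h).1)
    have hsub : ∀ y, (Function.update ρ x (some β) y).isSome → y = x ∨ (ρ y).isSome := by
      intro y hy
      by_cases h : y = x
      · exact Or.inl h
      · rw [Function.update_of_ne h] at hy; exact Or.inr hy
    refine ⟨Function.update ρ x (some β), ?_, ?_, ?_⟩
    · intro i
      by_cases hi : i = x.1
      · subst hi
        have : (Finset.univ.filter fun b => (Function.update ρ x (some β) (x.1, b)).isSome) ⊆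
            insert x.2 (Finset.univ.filter fun b => (ρ (x.1, b)).isSome) := by
          intro b hb
          simp only [Finset.mem_filter, Finset.mem_univ, true_and] at hb
          rcases hsub _ hb with h | h
          · exact Finset.mem_insert.2 (Or.inl (congrArg Prod.snd h))
          · exact Finset.mem_insert_of_mem (by simpa using h)
        have h4 := Finset.card_le_card this
        have h5 := Finset.card_insert_le x.2 (Finset.univ.filter fun b => (ρ (x.1, b)).isSome)
        omega
      · refine le_trans (Finset.card_le_card ?_) (h1 i)
        intro b hb
        simp only [Finset.mem_filter, Finset.mem_univ, true_and] at hb ⊢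
        rcases hsub _ hb with h | h
        · exact absurd (congrArg Prod.fst h) hi
        · exact h
    · have : (Finset.univ.filter fun y => (Function.update ρ x (some β) y).isSome) ⊆
            insert x (Finset.univ.filter fun y => (ρ y).isSome) := by
        intro b hb
        simp only [Finset.mem_filter, Finset.mem_univ, true_and] at hb
        rcases hsub _ hb with h | h
        · exact Finset.mem_insert.2 (Or.inl h)
        · exact Finset.mem_insert_of_mem (by simpa using h)
      have h4 := Finset.card_le_card this
      have h5 := Finset.card_insert_le x (Finset.univ.filter fun y => (ρ y).isSome)
      omega
    · have hle : (W.filter fun C => ¬ ∃ y γ, Function.update ρ x (some β) y = some γ ∧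
          ((Sum.inl y : PsiVar c k), γ) ∈ C) ⊆
          F.filter fun C => ¬ ((Sum.inl x : PsiVar c k), β) ∈ C := by
        intro C hCm
        simp only [hFdef, Finset.mem_filter] at hCm ⊢
        obtain ⟨hCW, hn⟩ := hCm
        refine ⟨⟨hCW, ?_⟩, ?_⟩
        · rintro ⟨y, γ, hy, hm⟩
          apply hn
          refine ⟨y, γ, ?_, hm⟩
          rw [Function.update_of_ne]
          · exact hy
          · rintro rfl
            rw [hx] at hy; cases hy
        · intro hm
          exact hn ⟨x, β, by simp, hm⟩
      have hle' := Finset.card_le_card hle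
      have hsplit := Finset.card_filter_add_card_filter_not (s := F)
        (fun C => ((Sum.inl x : PsiVar c k), β) ∈ C)
      set a := (F.filter fun C => ((Sum.inl x : PsiVar c k), β) ∈ C).card
      set b := (F.filter fun C => ¬ ((Sum.inl x : PsiVar c k), β) ∈ C).card
      have hN : (0 : ℝ) < 2 * (numIdx c k * k) := by
        have h7 : 0 < numIdx c k := lt_of_le_of_lt (Nat.zero_le _) x.1.2
        have h8 : 0 < k := lt_of_le_of_lt (Nat.zero_le _) x.2.2
        positivity
      set δ : ℝ := (q : ℝ) ^ 2 / (2 * (numIdx c k * k)) with hδ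
      have ha : (F.card : ℝ) * δ ≤ a := by
        rw [hδ, ← mul_div_assoc, div_le_iff₀ hN]
        exact_mod_cast hcard
      have hb : (b : ℝ) ≤ F.card * Real.exp (-δ) := by
        have h9 : (a : ℝ) + b = F.card := by exact_mod_cast hsplit
        have h10 := Real.add_one_le_exp (-δ)
        have h11 : (0 : ℝ) ≤ F.card := by positivity
        nlinarith
      calc ((W.filter fun C => ¬ ∃ y γ, Function.update ρ x (some β) y = some γ ∧
          ((Sum.inl y : PsiVar c k), γ) ∈ C).card : ℝ) ≤ b := by exact_mod_cast hle'
        _ ≤ F.card * Real.exp (-δ) := hb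
        _ ≤ (W.card * Real.exp (-(t * δ))) * Real.exp (-δ) := by gcongr
        _ = W.card * Real.exp (-((t + 1 : ℕ) * δ)) := by
          rw [mul_assoc, ← Real.exp_add]; congr 2; push_cast; ring

theorem length_bound {c : ℝ} (hc : 0 < c) {k q : ℕ} (hq : 0 < q) (hk1 : 8 * q ≤ k)
    (hk2 : k ≤ 15 * q) (G : SimpleGraph (Fin (2 ^ k))) (hQ : ExtProp q G)
    (R : Refutation (PsiCNF c G)) :
    ((2 ^ k : ℕ) : ℝ) ^ (1 / (101250 * (c + 1)) * k) ≤ (R.length : ℝ) := by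
  by_contra hlt
  push Not at hlt
  set W : Finset (Clause (PsiVar c k)) :=
    R.clauses.toFinset.filter fun C => 2 * q < (heavyIdx q C).card with hW
  obtain ⟨ρ, h1, -, h3⟩ := greedy hq W (fun C h => (Finset.mem_filter.1 h).2) (q ^ 2) le_rfl
  set F := W.filter fun C => ¬ ∃ x β, ρ x = some β ∧ ((Sum.inl x : PsiVar c k), β) ∈ C with hFdef
  have hWl : (W.card : ℝ) ≤ R.length := by
    have : W.card ≤ R.clauses.length :=
      le_trans (Finset.card_filter_le _ _) (List.toFinset_card_le _)
    exact_mod_cast this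
  have hkpos : (0 : ℝ) < k := by
    have : 0 < k := by omega
    exact_mod_cast this
  have hk2' : (k : ℝ) ≤ 15 * q := by exact_mod_cast hk2
  have hm : (numIdx c k : ℝ) ≤ (c + 1) * k := by
    have h4 : (numIdx c k : ℝ) < c * k + 1 := Nat.ceil_lt_add_one (by positivity)
    have h5 : (1 : ℝ) ≤ k := by
      have : 1 ≤ k := by omega
      exact_mod_cast this
    linarith
  have hmpos : (0 : ℝ) < numIdx c k := by
    have : 0 < numIdx c k := Nat.ceil_pos.2 (by positivity)
    exact_mod_cast this
  have hexp : 1 / (101250 * (c + 1)) * (k : ℝ) ^ 2 ≤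
      ((q ^ 2 : ℕ) : ℝ) * ((q : ℝ) ^ 2 / (2 * (numIdx c k * k))) := by
    push_cast
    rw [← mul_div_assoc, one_div_mul_eq_div, div_le_div_iff₀ (by positivity) (by positivity)]
    have hk4 : (k : ℝ) ^ 4 ≤ (15 * q) ^ 4 := by gcongr
    calc (k : ℝ) ^ 2 * (2 * (numIdx c k * k)) ≤ (k : ℝ) ^ 2 * (2 * ((c + 1) * k * k)) := by gcongr
      _ = 2 * (c + 1) * k ^ 4 := by ring
      _ ≤ 2 * (c + 1) * (15 * q) ^ 4 := by gcongr
      _ = _ := by ring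
  have hpow : ((2 ^ k : ℕ) : ℝ) ^ (1 / (101250 * (c + 1)) * k) ≤
      Real.exp (1 / (101250 * (c + 1)) * (k : ℝ) ^ 2) := by
    rw [Real.rpow_def_of_pos (by positivity)]
    apply Real.exp_le_exp.2
    push_cast
    rw [Real.log_pow]
    have hl : Real.log 2 ≤ 1 := by
      have := Real.log_two_lt_d9; linarith
    have h6 : 0 ≤ 1 / (101250 * (c + 1)) * (k : ℝ) ^ 2 := by positivity
    nlinarith
  have hF0 : (F.card : ℝ) < 1 := by
    calc (F.card : ℝ) ≤ _ := h3
      _ ≤ R.length * Real.exp (-(1 / (101250 * (c + 1)) * (k : ℝ) ^ 2)) := by gcongr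
      _ < Real.exp (1 / (101250 * (c + 1)) * (k : ℝ) ^ 2) *
          Real.exp (-(1 / (101250 * (c + 1)) * (k : ℝ) ^ 2)) := by
        have := Real.exp_pos (-(1 / (101250 * (c + 1)) * (k : ℝ) ^ 2))
        exact mul_lt_mul_of_pos_right (lt_of_lt_of_le hlt hpow) this
      _ = 1 := by rw [← Real.exp_add]; simp
  have hFe : F = ∅ := by
    have : F.card < 1 := by exact_mod_cast hF0
    exact Finset.card_eq_zero.1 (by omega)
  refine no_narrow (by omega) G hQ ρ h1 R ?_
  intro C hCR
  by_contra hcon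
  push Not at hcon
  have : C ∈ F := by
    simp only [hFdef, hW, Finset.mem_filter, List.mem_toFinset]
    refine ⟨⟨hCR, hcon.2⟩, ?_⟩
    rintro ⟨x, β, hx, hm⟩
    exact hcon.1 x β hx hm
  rw [hFe] at this
  simp at this

/-- Replace the edges between `U` and `W` according to `g`. -/
def swapGraph {V : Type} (U W : Finset V) (hd : Disjoint U W) (G : SimpleGraph V)
    (g : W → U → Bool) : SimpleGraph V where
  Adj x y := (∃ (hx : x ∈ U) (hy : y ∈ W), g ⟨y, hy⟩ ⟨x, hx⟩ = true) ∨
    (∃ (hy : y ∈ U) (hx : x ∈ W), g ⟨x, hx⟩ ⟨y, hy⟩ = true) ∨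
    (¬ (x ∈ U ∧ y ∈ W) ∧ ¬ (y ∈ U ∧ x ∈ W) ∧ G.Adj x y)
  symm := ⟨by
    rintro x y (h | h | ⟨h1, h2, h3⟩)
    · exact Or.inr (Or.inl h)
    · exact Or.inl h
    · exact Or.inr (Or.inr ⟨h2, h1, h3.symm⟩)⟩
  loopless := ⟨by
    rintro x (⟨h1, h2, -⟩ | ⟨h1, h2, -⟩ | ⟨-, -, h⟩)
    · exact Finset.disjoint_left.1 hd h1 h2
    · exact Finset.disjoint_left.1 hd h1 h2
    · exact G.loopless.irrefl _ h⟩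

theorem swapGraph_cross {V : Type} {U W : Finset V} (hd : Disjoint U W) (G : SimpleGraph V)
    (g : W → U → Bool) (u : U) (w : W) :
    (swapGraph U W hd G g).Adj u w ↔ g w u = true := by
  have h1 : (w : V) ∉ U := fun h => Finset.disjoint_left.1 hd h w.2
  simp [swapGraph, h1]

theorem bad_count {V : Type} [Fintype (SimpleGraph V)] (U W : Finset V) (hd : Disjoint U W) :
    (Finset.univ.filter fun G : SimpleGraph V => ∀ w ∈ W, ∃ u ∈ U, ¬ G.Adj u w).card *
      (2 ^ U.card) ^ W.card ≤ (2 ^ U.card - 1) ^ W.card * Fintype.card (SimpleGraph V) := by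
  have key : Fintype.card ({G : SimpleGraph V // ∀ w ∈ W, ∃ u ∈ U, ¬ G.Adj u w} ×
      (W → U → Bool)) ≤
      Fintype.card ((W → {h : U → Bool // h ≠ fun _ => true}) × SimpleGraph V) := by
    refine Fintype.card_le_of_injective
      (fun p => (fun w => ⟨fun u => decide (p.1.1.Adj u w), ?_⟩, swapGraph U W hd p.1.1 p.2)) ?_
    · obtain ⟨u, hu, hn⟩ := p.1.2 w w.2
      intro h
      have := congrFun h ⟨u, hu⟩
      simp only [decide_eq_true_eq] at this
      exact hn this
    · rintro ⟨⟨G, hG⟩, g⟩ ⟨⟨G', hG'⟩, g'⟩ h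
      simp only [Prod.mk.injEq] at h
      obtain ⟨h1, h2⟩ := h
      have hg : g = g' := by
        funext w u
        rw [Bool.eq_iff_iff, ← swapGraph_cross hd G g u w, ← swapGraph_cross hd G' g' u w, h2]
      have hcross : ∀ u ∈ U, ∀ w ∈ W, (G.Adj u w ↔ G'.Adj u w) := by
        intro u hu w hw
        have h3 := congrArg Subtype.val (congrFun h1 ⟨w, hw⟩)
        have h4 := congrFun h3 ⟨u, hu⟩
        simpa using h4
      have hGG : G = G' := by
        ext x y
        by_cases c1 : x ∈ U ∧ y ∈ W
        · exact hcross x c1.1 y c1.2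
        by_cases c2 : y ∈ U ∧ x ∈ W
        · rw [G.adj_comm, G'.adj_comm]; exact hcross y c2.1 x c2.2
        have e : ∀ (K : SimpleGraph V) (g : W → U → Bool),
            (swapGraph U W hd K g).Adj x y ↔ K.Adj x y := by
          intro K g
          constructor
          · rintro (⟨h1, h2, -⟩ | ⟨h1, h2, -⟩ | ⟨-, -, h⟩)
            · exact absurd ⟨h1, h2⟩ c1
            · exact absurd ⟨h1, h2⟩ c2
            · exact h
          · intro h
            exact Or.inr (Or.inr ⟨c1, c2, h⟩)
        rw [← e G g, ← e G' g', h2]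
      subst hg; subst hGG; rfl
  have hcs : Fintype.card {h : U → Bool // h ≠ fun _ => true} = 2 ^ U.card - 1 := by
    rw [Fintype.card_subtype_compl, Fintype.card_subtype_eq]
    simp
  rw [Fintype.card_prod, Fintype.card_prod, Fintype.card_fun, Fintype.card_fun, Fintype.card_fun,
    hcs, Fintype.card_bool, Fintype.card_coe, Fintype.card_coe, Fintype.card_subtype] at key
  exact key

theorem bad_prob {V : Type} [Fintype (SimpleGraph V)] (U W : Finset V) (hd : Disjoint U W) :
    probOf (fun G : SimpleGraph V => ∀ w ∈ W, ∃ u ∈ U, ¬ G.Adj u w) ≤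
      Real.exp (-(W.card / 2 ^ U.card)) := by
  have h := bad_count U W hd
  have h' : ((Finset.univ.filter fun G : SimpleGraph V => ∀ w ∈ W, ∃ u ∈ U, ¬ G.Adj u w).card : ℝ) *
      ((2 : ℝ) ^ U.card) ^ W.card ≤
      ((2 : ℝ) ^ U.card - 1) ^ W.card * Fintype.card (SimpleGraph V) := by
    have h1 : (1 : ℕ) ≤ 2 ^ U.card := Nat.one_le_two_pow
    have := (Nat.cast_le (α := ℝ)).2 h
    push_cast [Nat.cast_sub h1] at this
    exact this
  have hpos : (0 : ℝ) < Fintype.card (SimpleGraph V) := by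
    have : 0 < Fintype.card (SimpleGraph V) := Fintype.card_pos
    exact_mod_cast this
  have h2 : (0 : ℝ) < 2 ^ U.card := by positivity
  unfold probOf
  rw [div_le_iff₀ hpos]
  have h3 : (((2 : ℝ) ^ U.card - 1) / 2 ^ U.card) ^ W.card ≤ Real.exp (-(W.card / 2 ^ U.card)) := by
    have h4 : ((2 : ℝ) ^ U.card - 1) / 2 ^ U.card ≤ Real.exp (-(1 / 2 ^ U.card)) := by
      have := Real.add_one_le_exp (-(1 / (2 : ℝ) ^ U.card))
      rw [sub_div, div_self h2.ne']
      linarith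
    have h5 : 0 ≤ ((2 : ℝ) ^ U.card - 1) / 2 ^ U.card := by
      apply div_nonneg _ h2.le
      have : (1 : ℝ) ≤ 2 ^ U.card := one_le_pow₀ (by norm_num)
      linarith
    calc _ ≤ Real.exp (-(1 / 2 ^ U.card)) ^ W.card := by gcongr
      _ = _ := by rw [← Real.exp_nat_mul]; congr 1; ring
  have h6 : ((Finset.univ.filter fun G : SimpleGraph V => ∀ w ∈ W, ∃ u ∈ U, ¬ G.Adj u w).card : ℝ)
      ≤ (((2 : ℝ) ^ U.card - 1) / 2 ^ U.card) ^ W.card * Fintype.card (SimpleGraph V) := by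
    rw [div_pow, div_mul_eq_mul_div, le_div_iff₀ (by positivity)]
    exact h'
  refine le_trans (le_of_eq (by congr!)) (le_trans h6 ?_)
  gcongr

/-- vertices consistent with a pattern -/
theorem pattern_count {k s : ℕ} (p : Fin k → Option Bool)
    (hp : (Finset.univ.filter fun b => (p b).isSome).card ≤ s) :
    2 ^ (k - s) ≤ (Finset.univ.filter fun v : Fin (2 ^ k) =>
      ∀ (b : Fin k) (bit : Bool), p b = some bit → vbit v b = bit).card := by
  have hbij : Function.Bijective (fun (v : Fin (2 ^ k)) (b : Fin k) => vbit v b) := by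
    rw [Fintype.bijective_iff_injective_and_card]
    refine ⟨fun u v h => vbit_inj (fun b => congrFun h b), by simp⟩
  let T : Fin k → Finset Bool := fun b => Finset.univ.filter fun x => ∀ bit, p b = some bit → x = bit
  have hT : (Fintype.piFinset T).card ≤ (Finset.univ.filter fun v : Fin (2 ^ k) =>
      ∀ (b : Fin k) (bit : Bool), p b = some bit → vbit v b = bit).card := by
    refine le_trans ?_ (Finset.card_image_le
      (f := fun (v : Fin (2 ^ k)) (b : Fin k) => vbit v b))
    apply Finset.card_le_card
    intro f hf
    obtain ⟨v, rfl⟩ := hbij.2 f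
    refine Finset.mem_image.2 ⟨v, ?_, rfl⟩
    simp only [Fintype.mem_piFinset, T, Finset.mem_filter, Finset.mem_univ, true_and] at hf ⊢
    exact hf
  refine le_trans ?_ hT
  rw [Fintype.card_piFinset]
  have hc : ∀ b, (T b).card = if (p b).isSome then 1 else 2 := by
    intro b
    rcases hb : p b with _ | β
    · simp [T, hb]
    · have : T b = {β} := by
        ext x
        simp only [T, hb, Finset.mem_filter, Finset.mem_univ, true_and, Finset.mem_singleton,
          Option.some.injEq]
        exact ⟨fun h => h β rfl, fun h bit hbit => h.trans hbit⟩
      rw [this]; simp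
  simp only [hc]
  rw [Finset.prod_ite]
  simp only [Finset.prod_const_one, one_mul, Finset.prod_const]
  apply Nat.pow_le_pow_right (by norm_num)
  have := Finset.card_filter_add_card_filter_not (s := (Finset.univ : Finset (Fin k)))
    (fun b => (p b).isSome = true)
  simp only [Finset.card_univ, Fintype.card_fin] at this
  omega

theorem prob_union {α ι : Type} [Fintype α] (S : Finset ι) (P : α → Prop) (B : ι → α → Prop)
    (h : ∀ a, P a → ∃ i ∈ S, B i a) (x : ℝ) (hx : ∀ i ∈ S, probOf (B i) ≤ x) :
    probOf P ≤ S.card * x := by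
  calc probOf P ≤ ∑ i ∈ S, probOf (B i) := by
        unfold probOf
        rw [← Finset.sum_div]
        gcongr
        have : (Finset.univ.filter P) ⊆ S.biUnion fun i => Finset.univ.filter (B i) := by
          intro a ha
          simp only [Finset.mem_filter, Finset.mem_univ, true_and, Finset.mem_biUnion] at ha ⊢
          exact h a ha
        have := le_trans (Finset.card_le_card this) Finset.card_biUnion_le
        exact_mod_cast this
    _ ≤ S.card * x := by
        rw [← nsmul_eq_mul]
        exact Finset.sum_le_card_nsmul _ _ _ hx

/-- candidate common neighbours -/
noncomputable def candSet {k : ℕ} (U : Finset (Fin (2 ^ k))) (p : Fin k → Option Bool) :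
    Finset (Fin (2 ^ k)) :=
  (Finset.univ.filter fun v : Fin (2 ^ k) =>
      ∀ (b : Fin k) (bit : Bool), p b = some bit → vbit v b = bit) \ U

/-- index set of the union bound -/
noncomputable def unionIdx (k q : ℕ) : Finset (Finset (Fin (2 ^ k)) × (Fin k → Option Bool)) :=
  (Finset.powersetCard (2 * q) Finset.univ) ×ˢ
      (Finset.univ.filter fun p => (Finset.univ.filter fun b => (p b).isSome).card ≤ 3 * q)

theorem mem_unionIdx {k q : ℕ} (U : Finset (Fin (2 ^ k))) (p : Fin k → Option Bool) :
    (U, p) ∈ unionIdx k q ↔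
      U.card = 2 * q ∧ (Finset.univ.filter fun b => (p b).isSome).card ≤ 3 * q := by
  unfold unionIdx
  rw [Finset.mem_product, Finset.mem_powersetCard, Finset.mem_filter]
  exact ⟨fun h => ⟨h.1.2, h.2.2⟩, fun h => ⟨⟨Finset.subset_univ _, h.1⟩, Finset.mem_univ _, h.2⟩⟩

theorem small_q {q : ℕ} (hq : 0 < q) : 2 * q ≤ 2 ^ (5 * q - 1) := by
  have h1 : q < 2 ^ q := Nat.lt_two_pow_self
  calc 2 * q ≤ 2 * 2 ^ q := by omega
    _ = 2 ^ (q + 1) := by ring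
    _ ≤ 2 ^ (5 * q - 1) := Nat.pow_le_pow_right (by norm_num) (by omega)

theorem candSet_card {k q : ℕ} (hq : 0 < q) (hk1 : 8 * q ≤ k)
    (U : Finset (Fin (2 ^ k))) (p : Fin k → Option Bool) (hU : U.card = 2 * q)
    (hp : (Finset.univ.filter fun b => (p b).isSome).card ≤ 3 * q) :
    4 ^ q * 2 ^ (2 * q) ≤ (candSet U p).card := by
  have hqk := small_q hq
  have h1 := pattern_count p hp
  have h2 : (Finset.univ.filter fun v : Fin (2 ^ k) =>
      ∀ (b : Fin k) (bit : Bool), p b = some bit → vbit v b = bit).card - U.card ≤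
      (candSet U p).card := Finset.le_card_sdiff _ _
  have h3 : 2 ^ (5 * q) ≤ 2 ^ (k - 3 * q) := Nat.pow_le_pow_right (by norm_num) (by omega)
  have h4 : 2 ^ (5 * q) = 2 * 2 ^ (5 * q - 1) := by
    rw [← pow_succ']; congr 1; omega
  have h5 : 4 ^ q * 2 ^ (2 * q) ≤ 2 ^ (5 * q - 1) := by
    rw [show (4 : ℕ) = 2 ^ 2 by norm_num, ← pow_mul, ← pow_add]
    exact Nat.pow_le_pow_right (by norm_num) (by omega)
  generalize (Finset.univ.filter fun v : Fin (2 ^ k) =>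
      ∀ (b : Fin k) (bit : Bool), p b = some bit → vbit v b = bit).card = X at h1 h2
  generalize 2 ^ (k - 3 * q) = Y at h1 h3
  generalize 2 ^ (5 * q - 1) = Z at *
  rw [hU] at h2
  refine le_trans h5 (le_trans ?_ h2)
  omega

theorem item_prob {k q : ℕ} (hq : 0 < q) (hk1 : 8 * q ≤ k)
    (U : Finset (Fin (2 ^ k))) (p : Fin k → Option Bool) (hU : U.card = 2 * q)
    (hp : (Finset.univ.filter fun b => (p b).isSome).card ≤ 3 * q) :
    probOf (fun G : SimpleGraph (Fin (2 ^ k)) => ∀ w ∈ candSet U p, ∃ u ∈ U, ¬ G.Adj u w) ≤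
      Real.exp (-(4 ^ q)) := by
  have hd : Disjoint U (candSet U p) := by
    unfold candSet
    exact Finset.disjoint_sdiff
  refine le_trans (bad_prob U (candSet U p) hd) ?_
  apply Real.exp_le_exp.2
  apply neg_le_neg
  rw [le_div_iff₀ (by positivity), hU]
  have h6 := candSet_card hq hk1 U p hU hp
  have h7 := (Nat.cast_le (α := ℝ)).2 h6
  push_cast at h7
  exact h7

theorem unionIdx_card {k q : ℕ} (hk2 : k ≤ 15 * q) :
    (unionIdx k q).card ≤ 2 ^ (60 * q ^ 2) := by
  calc (unionIdx k q).card ≤ (2 ^ k) ^ (2 * q) * 3 ^ k := by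
        unfold unionIdx
        rw [Finset.card_product]
        apply Nat.mul_le_mul
        · rw [Finset.card_powersetCard, Finset.card_univ, Fintype.card_fin]
          exact Nat.choose_le_pow _ _
        · refine le_trans (Finset.card_le_univ _) ?_
          rw [Fintype.card_fun, Fintype.card_option, Fintype.card_bool, Fintype.card_fin]
    _ ≤ (2 ^ k) ^ (2 * q) * 4 ^ k := by gcongr; norm_num
    _ = 2 ^ (k * (2 * q) + 2 * k) := by
        rw [show (4 : ℕ) = 2 ^ 2 by norm_num, ← pow_mul, ← pow_mul, ← pow_add]
    _ ≤ 2 ^ (60 * q ^ 2) := by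
        apply Nat.pow_le_pow_right (by norm_num)
        have h1 : q ≤ q ^ 2 := Nat.le_self_pow two_ne_zero q
        have h2 := Nat.mul_le_mul_right (2 * q) hk2
        nlinarith

theorem fail_cover {k q : ℕ} (hq : 0 < q) (hk1 : 8 * q ≤ k)
    (G : SimpleGraph (Fin (2 ^ k))) (hG : ¬ ExtProp q G) :
    ∃ s ∈ unionIdx k q, ∀ w ∈ candSet s.1 s.2, ∃ u ∈ s.1, ¬ G.Adj u w := by
  unfold ExtProp at hG
  push Not at hG
  obtain ⟨U, hU, p, hp, hno⟩ := hG
  obtain ⟨U', hUU, hU'⟩ := Finset.exists_superset_card_eq (s := U) (n := 2 * q) hU (by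
    rw [Fintype.card_fin]
    exact le_trans (small_q hq) (Nat.pow_le_pow_right (by norm_num) (by omega)))
  refine ⟨(U', p), (mem_unionIdx U' p).2 ⟨hU', hp⟩, ?_⟩
  intro w hw
  simp only [candSet, Finset.mem_sdiff, Finset.mem_filter, Finset.mem_univ, true_and] at hw
  by_contra hcon
  push Not at hcon
  obtain ⟨b, bit, h1, h2⟩ := hno w (fun u hu => hcon u (hUU hu))
  exact h2 (hw.1 b bit h1)

theorem fail_prob {k q : ℕ} (hq : 0 < q) (hk1 : 8 * q ≤ k) (hk2 : k ≤ 15 * q) :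
    probOf (fun G : SimpleGraph (Fin (2 ^ k)) => ¬ ExtProp q G) ≤
      Real.exp (60 * q ^ 2 - 4 ^ q) := by
  have hu := prob_union (unionIdx k q) (fun G : SimpleGraph (Fin (2 ^ k)) => ¬ ExtProp q G)
    (fun s G => ∀ w ∈ candSet s.1 s.2, ∃ u ∈ s.1, ¬ G.Adj u w)
    (fun G hG => fail_cover hq hk1 G hG)
    (Real.exp (-(4 ^ q))) (by
      rintro ⟨U, p⟩ hs
      have hs' := (mem_unionIdx U p).1 hs
      exact item_prob hq hk1 U p hs'.1 hs'.2)
  refine le_trans hu ?_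
  rw [sub_eq_add_neg, Real.exp_add]
  apply mul_le_mul_of_nonneg_right _ (Real.exp_pos _).le
  have hS := (Nat.cast_le (α := ℝ)).2 (unionIdx_card hk2)
  push_cast at hS
  refine le_trans hS ?_
  calc (2 : ℝ) ^ (60 * q ^ 2) ≤ Real.exp 1 ^ (60 * q ^ 2) := by
        gcongr
        have := Real.exp_one_gt_d9; linarith
    _ = _ := by rw [← Real.exp_nat_mul]; push_cast; rw [mul_one]

theorem exp_tendsto :
    Filter.Tendsto (fun q : ℕ => Real.exp (60 * (q : ℝ) ^ 2 - 4 ^ q)) Filter.atTop (nhds 0) := by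
  apply Real.tendsto_exp_atBot.comp
  have h1 := tendsto_pow_const_div_const_pow_of_one_lt 2 (r := (4 : ℝ)) (by norm_num)
  have h2 : Filter.Tendsto (fun q : ℕ => (4 : ℝ) ^ q) Filter.atTop Filter.atTop :=
    tendsto_pow_atTop_atTop_of_one_lt (by norm_num)
  have h3 : Filter.Tendsto (fun q : ℕ => 60 * ((q : ℝ) ^ 2 / 4 ^ q) - 1) Filter.atTop
      (nhds (60 * 0 - 1)) := (h1.const_mul 60).sub_const 1
  have h4 := h2.atTop_mul_neg (by norm_num) h3
  refine h4.congr ?_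
  intro q
  have : (4 : ℝ) ^ q ≠ 0 := by positivity
  field_simp

theorem prob_compl {α : Type} [Fintype α] [Nonempty α] (P : α → Prop) :
    1 - probOf (fun a => ¬ P a) = probOf P := by
  unfold probOf
  have h := Finset.card_filter_add_card_filter_not (s := (Finset.univ : Finset α)) P
  have hpos : (0 : ℝ) < Fintype.card α := by exact_mod_cast Fintype.card_pos
  rw [Finset.card_univ] at h
  rw [sub_eq_iff_eq_add, ← add_div, eq_div_iff hpos.ne', one_mul]
  have h2 : (Fintype.card α : ℝ) = (Finset.univ.filter P).card +
      (Finset.univ.filter fun a => ¬ P a).card := by exact_mod_cast h.symm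
  convert h2

theorem prob_mono {α : Type} [Fintype α] {P Q : α → Prop} (h : ∀ a, P a → Q a) :
    probOf P ≤ probOf Q := by
  unfold probOf
  gcongr
  exact h _

theorem prob_le_one {α : Type} [Fintype α] (P : α → Prop) : probOf P ≤ 1 := by
  unfold probOf
  apply div_le_one_of_le₀ _ (by positivity)
  exact_mod_cast Finset.card_le_univ _

/-- Fix `c > 0`. There is `ε > 0` such that for a random graph `G` from
`G(n, 1/2)` with `n = 2^k` (uniform on `SimpleGraph (Fin (2^k))`), with probability
tending to `1` as `n → ∞`, every resolution refutation of `Ψ_G` has length at least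
`n^(ε·log₂ n) = n^(ε·k)`. -/
theorem random_graph_psi_lower_bound (c : ℝ) (hc : 0 < c) :
    ∃ ε : ℝ, 0 < ε ∧
      Filter.Tendsto
        (fun k : ℕ => probOf (fun G : SimpleGraph (Fin (2 ^ k)) =>
          ∀ R : Refutation (PsiCNF c G), ((2 ^ k : ℕ) : ℝ) ^ (ε * k) ≤ (R.length : ℝ)))
        Filter.atTop (nhds 1) := by
  refine ⟨1 / (101250 * (c + 1)), by positivity, ?_⟩
  have hlow : Filter.Tendsto (fun k : ℕ => 1 - Real.exp (60 * ((k / 8 : ℕ) : ℝ) ^ 2 - 4 ^ (k / 8)))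
      Filter.atTop (nhds 1) := by
    have h1 := exp_tendsto.comp (Nat.tendsto_div_const_atTop (n := 8) (by norm_num))
    have h2 := h1.const_sub 1
    simpa using h2
  refine tendsto_of_tendsto_of_tendsto_of_le_of_le' hlow tendsto_const_nhds ?_
    (Filter.Eventually.of_forall fun k => prob_le_one _)
  filter_upwards [Filter.eventually_ge_atTop 8] with k hk
  have hq : 0 < k / 8 := by omega
  have h1 := fail_prob (k := k) hq (by omega) (by omega)
  have h2 := prob_compl (fun G : SimpleGraph (Fin (2 ^ k)) => ExtProp (k / 8) G)
  have h3 : probOf (fun G : SimpleGraph (Fin (2 ^ k)) => ExtProp (k / 8) G) ≤ probOf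
      (fun G : SimpleGraph (Fin (2 ^ k)) => ∀ R : Refutation (PsiCNF c G),
        ((2 ^ k : ℕ) : ℝ) ^ (1 / (101250 * (c + 1)) * k) ≤ (R.length : ℝ)) :=
    prob_mono fun G hG R => length_bound hc hq (by omega) (by omega) G hG R
  linarith
end

section
/- Fix a constant c > 0. Let G be a graph on n = 2^k vertices that has property P. Then the Adversary has a strategy in the Prover–Adversary game on the CNF Clique(G) that wins against every Prover who uses at most k²/9 memory locations. -/
open Classical
/-- Number of stored bits of index `i`. -/
noncomputable def storedCount {N k : ℕ} (m : Fin N × Fin k → Option Bool) (i : Fin N) : ℕ :=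
  (Finset.univ.filter fun b => (m (i, b)).isSome).card

/-- Positions the Adversary keeps: all indices with more than `k/3` stored bits can be
simultaneously mapped to a clique, consistently with the memory. -/
def GoodMem {N k : ℕ} (G : SimpleGraph (Fin (2 ^ k))) (m : Fin N × Fin k → Option Bool) : Prop :=
  ∃ f : Fin N → Fin (2 ^ k),
    (∀ i, k < 3 * storedCount m i → ∀ b bit, m (i, b) = some bit → vbit (f i) b = bit) ∧
    ∀ i j, i ≠ j → k < 3 * storedCount m i → k < 3 * storedCount m j → G.Adj (f i) (f j)

theorem goodMem_none {N k : ℕ} (G : SimpleGraph (Fin (2 ^ k))) :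
    GoodMem G (fun _ : Fin N × Fin k => none) := by
  refine ⟨fun _ => ⟨0, by positivity⟩, ?_, ?_⟩ <;> simp [storedCount]

theorem goodMem_mono {N k : ℕ} (G : SimpleGraph (Fin (2 ^ k)))
    (m m' : Fin N × Fin k → Option Bool) (h : GoodMem G m)
    (hm : ∀ x bit, m' x = some bit → m x = some bit) : GoodMem G m' := by
  obtain ⟨f, h1, h2⟩ := h
  have hc : ∀ i, storedCount m' i ≤ storedCount m i := by
    intro i
    refine Finset.card_le_card ?_
    intro b hb
    simp only [Finset.mem_filter, Finset.mem_univ, true_and, Option.isSome_iff_exists] at hb ⊢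
    obtain ⟨a, ha⟩ := hb
    exact ⟨a, hm _ _ ha⟩
  refine ⟨f, fun i hi b bit hb => h1 i ?_ b bit (hm _ _ hb), fun i j hij hi hj => h2 i j hij ?_ ?_⟩
  · have := hc i; omega
  · have := hc i; omega
  · have := hc j; omega

theorem sum_storedCount {N k : ℕ} (m : Fin N × Fin k → Option Bool) :
    ∑ i, storedCount m i = (Finset.univ.filter fun x => (m x).isSome).card := by
  simp only [storedCount, Finset.card_filter, Fintype.sum_prod_type]

theorem heavy_card {N k : ℕ} (m : Fin N × Fin k → Option Bool) (hk : 0 < k)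
    (hs : 9 * (Finset.univ.filter fun x => (m x).isSome).card ≤ k ^ 2) :
    3 * (Finset.univ.filter fun i => k < 3 * storedCount m i).card ≤ k := by
  rw [← sum_storedCount] at hs
  set H := Finset.univ.filter fun i => k < 3 * storedCount m i with hH
  have h1 : H.card * k ≤ ∑ i ∈ H, 3 * storedCount m i := by
    rw [← smul_eq_mul]
    refine Finset.card_nsmul_le_sum _ _ _ ?_
    intro i hi
    rw [hH, Finset.mem_filter] at hi
    exact hi.2.le
  have h2 : ∑ i ∈ H, 3 * storedCount m i ≤ ∑ i, 3 * storedCount m i :=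
    Finset.sum_le_sum_of_subset (Finset.subset_univ _)
  rw [← Finset.mul_sum (s := Finset.univ)] at h2
  have h3 : (3 * H.card) * k ≤ k * k := by nlinarith
  exact Nat.le_of_mul_le_mul_right h3 hk

theorem storedCount_congr {N k : ℕ} (m m' : Fin N × Fin k → Option Bool) (i : Fin N)
    (h : ∀ b, m' (i, b) = m (i, b)) : storedCount m' i = storedCount m i := by
  simp only [storedCount, h]

theorem goodMem_query {N k : ℕ} (G : SimpleGraph (Fin (2 ^ k))) (hG : PropertyP G)
    (m : Fin N × Fin k → Option Bool) (h : GoodMem G m)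
    (hs : 9 * (Finset.univ.filter fun x => (m x).isSome).card ≤ k ^ 2)
    (x : Fin N × Fin k) :
    ∃ bit : Bool, GoodMem G (Function.update m x (some bit)) := by
  obtain ⟨f, h1, h2⟩ := h
  obtain ⟨i, b⟩ := x
  have hk : 0 < k := by have := b.2; omega
  have hne : ∀ bit j, j ≠ i → ∀ b', Function.update m (i, b) (some bit) (j, b') = m (j, b') := by
    intro bit j hj b'
    rw [Function.update_of_ne]
    simp [hj]
  have hcne : ∀ bit j, j ≠ i →
      storedCount (Function.update m (i, b) (some bit)) j = storedCount m j :=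
    fun bit j hj => storedCount_congr _ _ _ (hne bit j hj)
  have hex : ∃ v : Fin (2 ^ k), (∀ b' bit, m (i, b') = some bit → vbit v b' = bit) ∧
      ∀ j, j ≠ i → k < 3 * storedCount m j → G.Adj (f j) v := by
    by_cases hi : k < 3 * storedCount m i
    · exact ⟨f i, h1 i hi, fun j hj hjh => h2 j i hj hjh hi⟩
    · have hH := heavy_card m hk hs
      have hU := Finset.card_image_le (f := f)
        (s := Finset.univ.filter fun i => k < 3 * storedCount m i)
      obtain ⟨v, hv1, hv2⟩ := hG _ (le_trans (Nat.mul_le_mul_left 3 hU) hH)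
        (fun b => m (i, b)) (by simpa [storedCount] using hi)
      refine ⟨v, hv2, fun j _ hjh => hv1 _ (Finset.mem_image_of_mem f ?_)⟩
      simpa using hjh
  obtain ⟨v, hv1, hv2⟩ := hex
  refine ⟨vbit v b, Function.update f i v, ?_, ?_⟩
  · intro j hj b' bit hb
    by_cases hji : j = i
    · subst hji
      rw [Function.update_self]
      by_cases hbb : b' = b
      · subst hbb
        rw [Function.update_self] at hb
        exact Option.some.inj hb
      · rw [Function.update_of_ne (by simp [hbb])] at hb
        exact hv1 _ _ hb
    · rw [hcne _ _ hji] at hj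
      rw [hne _ _ hji] at hb
      rw [Function.update_of_ne hji]
      exact h1 j hj _ _ hb
  · intro j l hjl hj hl
    by_cases hji : j = i
    · subst hji
      rw [hcne _ _ hjl.symm] at hl
      rw [Function.update_self, Function.update_of_ne hjl.symm]
      exact (hv2 l hjl.symm hl).symm
    · rw [hcne _ _ hji] at hj
      rw [Function.update_of_ne hji]
      by_cases hli : l = i
      · subst hli
        rw [Function.update_self]
        exact hv2 j hji hj
      · rw [hcne _ _ hli] at hl
        rw [Function.update_of_ne hli]
        exact h2 j l hjl hj hl

theorem vbit_ext {k : ℕ} (u v : Fin (2 ^ k)) (h : ∀ b, vbit u b = vbit v b) : u = v := by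
  apply Fin.ext
  apply Nat.eq_of_testBit_eq
  intro n
  by_cases hn : n < k
  · exact h ⟨n, hn⟩
  · have hp : 2 ^ k ≤ 2 ^ n := Nat.pow_le_pow_right (by norm_num) (by omega)
    rw [Nat.testBit_lt_two_pow (lt_of_lt_of_le u.2 hp),
      Nat.testBit_lt_two_pow (lt_of_lt_of_le v.2 hp)]

theorem goodMem_adj {N k : ℕ} (G : SimpleGraph (Fin (2 ^ k)))
    (m : Fin N × Fin k → Option Bool) (h : GoodMem G m) (hk : 0 < k) (i j : Fin N)
    (hij : i ≠ j) (u v : Fin (2 ^ k)) (hu : ∀ b, m (i, b) = some (vbit u b))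
    (hv : ∀ b, m (j, b) = some (vbit v b)) : G.Adj u v := by
  obtain ⟨f, h1, h2⟩ := h
  have hci : k < 3 * storedCount m i := by simp [storedCount, hu]; omega
  have hcj : k < 3 * storedCount m j := by simp [storedCount, hv]; omega
  have hfi : f i = u := vbit_ext _ _ fun b => h1 i hci b _ (hu b)
  have hfj : f j = v := vbit_ext _ _ fun b => h1 j hcj b _ (hv b)
  rw [← hfi, ← hfj]
  exact h2 i j hij hci hcj

/-- Fix `c > 0` and let `G` be a graph on `n = 2^k` vertices with
property P. Then the Adversary has a strategy in the game on `Clique(G)` winning against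
every Prover who uses at most `k²/9` memory locations. -/
theorem adversary_wins_propertyP (c : ℝ) (hc : 0 < c) (k : ℕ)
    (G : SimpleGraph (Fin (2 ^ k))) (hG : PropertyP G) :
    AdversaryWinsAgainst (CliqueCNF c G) ((k : ℝ) ^ 2 / 9) := by
  refine ⟨fun h x => if GoodMem G (Function.update (memOf h) x (some true)) then true else false,
    ?_⟩
  intro P hM t C hC hf
  have hgood : ∀ t, GoodMem G (memOf (play P (fun h x =>
      if GoodMem G (Function.update (memOf h) x (some true)) then true else false) t)) := by
    intro t
    induction t with
    | zero => exact goodMem_none G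
    | succ t ih =>
      have hMt := hM t
      simp only [play]
      generalize play P (fun h x =>
        if GoodMem G (Function.update (memOf h) x (some true)) then true else false) t = h
        at ih hMt ⊢
      cases hP : P h with
      | query x =>
        have hs : 9 * memSize h ≤ k ^ 2 := by
          have h9 : (9 * memSize h : ℝ) ≤ (k : ℝ) ^ 2 := by linarith
          exact_mod_cast h9
        obtain ⟨bit, hb⟩ := goodMem_query G hG (memOf h) ih (by simpa [memSize] using hs) x
        simp only [memOf]
        by_cases ht : GoodMem G (Function.update (memOf h) x (some true))
        · rw [if_pos ht]; exact ht
        · rw [if_neg ht]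
          cases bit
          · exact hb
          · exact absurd hb ht
      | forget x =>
        simp only [memOf]
        refine goodMem_mono G _ _ ih ?_
        intro y bit hy
        by_cases hyx : y = x
        · subst hyx; simp at hy
        · rwa [Function.update_of_ne hyx] at hy
  have key : ∀ (i j : Fin (numIdx c k)) (u v : Fin (2 ^ k)), i ≠ j →
      C = neqClause c k i u ∪ neqClause c k j v → G.Adj u v := by
    intro i j u v hij hCe
    have hk : 0 < k := by
      rcases Nat.eq_zero_or_pos k with h0 | h0
      · have := i.2
        subst h0
        simp [numIdx] at this
      · exact h0
    refine goodMem_adj G _ (hgood t) hk i j hij u v ?_ ?_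
    · intro b
      have := hf ((i, b), ! vbit u b) (by
        rw [hCe]
        exact Finset.mem_union_left _ (Finset.mem_image_of_mem _ (Finset.mem_univ b)))
      simpa using this
    · intro b
      have := hf ((j, b), ! vbit v b) (by
        rw [hCe]
        exact Finset.mem_union_right _ (Finset.mem_image_of_mem _ (Finset.mem_univ b)))
      simpa using this
  rcases hC with ⟨i, j, hij, v, hCe⟩ | ⟨i, j, hij, u, v, _, hadj, hCe⟩
  · exact G.irrefl (key i j v v hij hCe)
  · exact hadj (key i j u v hij hCe)
end

section
/- Fix a constant c > 0. There exist constants β > 0 and δ > 0 such that for every sufficiently large n, every c-Ramsey graph G on n vertices contains a set S ⊆ V(G) with |S| ≥ n^{3/4} such that for all A, B ⊆ S with |A|, |B| ≥ |S|^{1−β}, one has δ ≤ d(A,B) ≤ 1 − δ. -/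
open Classical
/-- Off-diagonal Ramsey with weights. -/
lemma weighted_ramsey {V : Type} (G : SimpleGraph V) (x : ℝ) (hx : 0 < x) :
    ∀ m s t : ℕ, s + t = m → ∀ S : Finset V,
      (1 + 1 / x) ^ s * (1 + x) ^ t - 1 ≤ (S.card : ℝ) →
      (∃ T ⊆ S, G.IsClique (T : Set V) ∧ T.card = s) ∨
      (∃ T ⊆ S, Gᶜ.IsClique (T : Set V) ∧ T.card = t) := by
  intro m
  induction m with
  | zero =>
    intro s t hst S _
    left
    exact ⟨∅, by simp, by simp, by simp; omega⟩
  | succ m ih =>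
    intro s t hst S hS
    rcases s with _ | s
    · left; exact ⟨∅, by simp, by simp, by simp⟩
    rcases t with _ | t
    · right; exact ⟨∅, by simp, by simp, by simp⟩
    have hxi : 0 < 1 / x := by positivity
    have h1 : 1 < (1 + 1 / x) ^ (s+1) := one_lt_pow₀ (by linarith) (by omega)
    have h2 : 1 < (1 + x) ^ (t+1) := one_lt_pow₀ (by linarith) (by omega)
    have h3 : 1 < (1 + 1 / x) ^ (s+1) * (1 + x) ^ (t+1) := by nlinarith
    have hne : S.Nonempty := by
      rw [← Finset.card_pos]
      have : (0:ℝ) < S.card := by linarith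
      exact_mod_cast this
    obtain ⟨v, hv⟩ := hne
    set N := (S.erase v).filter (fun w => G.Adj v w) with hN
    set M := (S.erase v).filter (fun w => ¬ G.Adj v w) with hM
    have hcard : N.card + M.card + 1 = S.card := by
      rw [hN, hM, Finset.card_filter_add_card_filter_not, Finset.card_erase_add_one hv]
    have hcard' : (N.card : ℝ) + M.card + 1 = S.card := by exact_mod_cast hcard
    have hsplit : (1 + 1 / x) ^ (s+1) * (1 + x) ^ (t+1)
        = (1 + 1 / x) ^ s * (1 + x) ^ (t+1) + (1 + 1 / x) ^ (s+1) * (1 + x) ^ t := by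
      have hxx : x * (1 / x) = 1 := by field_simp
      rw [pow_succ (1 + 1 / x) s, pow_succ (1 + x) t]
      linear_combination ((1 + 1 / x) ^ s * (1 + x) ^ t) * hxx
    have hNS : N ⊆ S := (Finset.filter_subset _ _).trans (Finset.erase_subset _ _)
    have hMS : M ⊆ S := (Finset.filter_subset _ _).trans (Finset.erase_subset _ _)
    by_cases hc : (1 + 1 / x) ^ s * (1 + x) ^ (t+1) - 1 ≤ (N.card : ℝ)
    · rcases ih s (t+1) (by omega) N hc with ⟨T, hT, hcl, hTc⟩ | ⟨T, hT, hcl, hTc⟩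
      · left
        have hvT : v ∉ T := fun h => by
          have := hT h; simp [hN] at this
        refine ⟨insert v T, Finset.insert_subset hv (hT.trans hNS), ?_, ?_⟩
        · rw [Finset.coe_insert]
          refine hcl.insert fun b hb _ => ?_
          have := hT hb
          simp [hN] at this
          exact this.2
        · rw [Finset.card_insert_of_notMem hvT, hTc]
      · right; exact ⟨T, hT.trans hNS, hcl, hTc⟩
    · have hc2 : (1 + 1 / x) ^ (s+1) * (1 + x) ^ t - 1 ≤ (M.card : ℝ) := by
        linarith
      rcases ih (s+1) t (by omega) M hc2 with ⟨T, hT, hcl, hTc⟩ | ⟨T, hT, hcl, hTc⟩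
      · left; exact ⟨T, hT.trans hMS, hcl, hTc⟩
      · right
        have hvT : v ∉ T := fun h => by
          have := hT h; simp [hM] at this
        refine ⟨insert v T, Finset.insert_subset hv (hT.trans hMS), ?_, ?_⟩
        · rw [Finset.coe_insert]
          refine hcl.insert fun b hb hne => ?_
          have := hT hb
          simp [hM] at this
          rw [SimpleGraph.compl_adj]
          exact ⟨hne, this.2⟩
        · rw [Finset.card_insert_of_notMem hvT, hTc]

lemma pairs_card {V : Type} (G : SimpleGraph V) (A B : Finset V) :
    ((A ×ˢ B).filter fun ab => G.Adj ab.1 ab.2).card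
      = ∑ a ∈ A, (B.filter fun b => G.Adj a b).card := by
  simp only [Finset.card_filter]
  rw [Finset.sum_product]

lemma clean_side {V : Type} (G : SimpleGraph V) (A B : Finset V) (δ : ℝ) (hδ : 0 < δ)
    (hB : 0 < (B.card : ℝ))
    (h : (((A ×ˢ B).filter fun ab => G.Adj ab.1 ab.2).card : ℝ) ≤ δ * (A.card * B.card)) :
    (A.card : ℝ) ≤ 2 * ((A.filter fun a =>
      ((B.filter fun b => G.Adj a b).card : ℝ) ≤ 2 * δ * B.card).card : ℝ) := by
  rw [pairs_card] at h
  push_cast at h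
  set A1 := A.filter fun a => ((B.filter fun b => G.Adj a b).card : ℝ) ≤ 2 * δ * B.card
  set A2 := A.filter fun a => ¬ ((B.filter fun b => G.Adj a b).card : ℝ) ≤ 2 * δ * B.card with hA2
  have hc : A1.card + A2.card = A.card := Finset.card_filter_add_card_filter_not _
  have hc' : (A1.card : ℝ) + A2.card = A.card := by exact_mod_cast hc
  have h1 : (A2.card : ℝ) * (2 * δ * B.card) ≤ ∑ a ∈ A2, ((B.filter fun b => G.Adj a b).card : ℝ) := by
    rw [← nsmul_eq_mul]
    apply Finset.card_nsmul_le_sum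
    intro a ha
    rw [hA2, Finset.mem_filter] at ha
    linarith [ha.2]
  have h2 : ∑ a ∈ A2, ((B.filter fun b => G.Adj a b).card : ℝ)
      ≤ ∑ a ∈ A, ((B.filter fun b => G.Adj a b).card : ℝ) :=
    Finset.sum_le_sum_of_subset_of_nonneg (Finset.filter_subset _ _) (fun _ _ _ => by positivity)
  have h3 : (2 * (A2.card : ℝ)) * (δ * B.card) ≤ A.card * (δ * B.card) := by nlinarith
  have h4 := le_of_mul_le_mul_right h3 (by positivity)
  linarith

lemma small_subsets {V : Type} (X : Finset V) (z K γ : ℝ) (hz : 0 < z) (hz1 : z ≤ 1)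
    (hγ : 0 < γ) (hK : (X.card : ℝ) ≤ K) :
    ((X.powerset.filter fun Y => (Y.card : ℝ) ≤ γ * X.card).card : ℝ)
      ≤ (1 + z) ^ K * z ^ (-(γ * K)) := by
  have h1 : ∑ Y ∈ X.powerset, z ^ Y.card = (1 + z) ^ X.card := by
    have := Finset.sum_pow_mul_eq_add_pow z 1 X
    simpa [add_comm] using this
  have h2 : ((X.powerset.filter fun Y => (Y.card : ℝ) ≤ γ * X.card).card : ℝ) * z ^ (γ * K)
      ≤ ∑ Y ∈ X.powerset, z ^ Y.card := by
    refine le_trans ?_ (Finset.sum_le_sum_of_subset_of_nonneg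
      (Finset.filter_subset (fun Y => (Y.card : ℝ) ≤ γ * X.card) _) (fun _ _ _ => by positivity))
    rw [← nsmul_eq_mul]
    apply Finset.card_nsmul_le_sum
    intro Y hY
    rw [Finset.mem_filter] at hY
    rw [← Real.rpow_natCast]
    apply Real.rpow_le_rpow_of_exponent_ge hz hz1
    nlinarith [hY.2]
  have h3 : (1 + z) ^ X.card ≤ (1 + z) ^ K := by
    rw [← Real.rpow_natCast]
    exact Real.rpow_le_rpow_of_exponent_le (by linarith) hK
  rw [Real.rpow_neg hz.le, ← div_eq_mul_inv, le_div_iff₀ (by positivity)]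
  linarith

lemma trace_lemma {V : Type} (G : SimpleGraph V) (X B : Finset V) (z K γ : ℝ) (hz : 0 < z)
    (hz1 : z ≤ 1) (hγ : 0 < γ) (hK : (X.card : ℝ) ≤ K) (hKB : 4 * K ≤ B.card)
    (hX : ∀ a ∈ X, ((B.filter fun b => G.Adj a b).card : ℝ) ≤ 2 * (γ / 8) * B.card) :
    ∃ Y ⊆ X, (Y.card : ℝ) ≤ γ * X.card ∧ ∃ W ⊆ B, Disjoint W X ∧
      (∀ w ∈ W, ∀ x ∈ X, G.Adj x w → x ∈ Y) ∧
      (B.card : ℝ) ≤ 2 * ((1 + z) ^ K * z ^ (-(γ * K))) * W.card := by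
  set tr : V → Finset V := fun b => X.filter fun x => G.Adj x b with htr
  set B1 := B.filter fun b => ((tr b).card : ℝ) ≤ γ * X.card with hB1
  set B2 := B.filter fun b => ¬ ((tr b).card : ℝ) ≤ γ * X.card with hB2
  have hc : B1.card + B2.card = B.card := Finset.card_filter_add_card_filter_not _
  have hc' : (B1.card : ℝ) + B2.card = B.card := by exact_mod_cast hc
  have hdc : ∑ b ∈ B, ((tr b).card : ℝ) = ∑ a ∈ X, ((B.filter fun b => G.Adj a b).card : ℝ) := by
    have : ∑ b ∈ B, (tr b).card = ∑ a ∈ X, (B.filter fun b => G.Adj a b).card := by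
      simp only [htr, Finset.card_filter]
      exact Finset.sum_comm
    exact_mod_cast this
  have hup : ∑ a ∈ X, ((B.filter fun b => G.Adj a b).card : ℝ) ≤ X.card * (2 * (γ / 8) * B.card) := by
    rw [← nsmul_eq_mul]
    exact Finset.sum_le_card_nsmul _ _ _ hX
  have hlow : (B2.card : ℝ) * (γ * X.card) ≤ ∑ b ∈ B, ((tr b).card : ℝ) := by
    refine le_trans ?_ (Finset.sum_le_sum_of_subset_of_nonneg
      (Finset.filter_subset (fun b => ¬ ((tr b).card : ℝ) ≤ γ * X.card) _)
      (fun _ _ _ => by positivity))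
    rw [← nsmul_eq_mul]
    apply Finset.card_nsmul_le_sum
    intro b hb
    rw [Finset.mem_filter] at hb
    linarith [hb.2]
  have hB2c : (B2.card : ℝ) ≤ B.card / 4 := by
    rcases Nat.eq_zero_or_pos X.card with h0 | h0
    · have : B2 = ∅ := by
        rw [hB2, Finset.filter_eq_empty_iff]
        intro b _
        have : X = ∅ := Finset.card_eq_zero.mp h0
        simp [htr, this]
      rw [this]; simp; positivity
    · have h0' : (0:ℝ) < X.card := by exact_mod_cast h0
      have : (B2.card : ℝ) * (γ * X.card) ≤ (B.card / 4) * (γ * X.card) := by nlinarith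
      exact le_of_mul_le_mul_right this (by positivity)
  set B3 := B1 \ X with hB3
  have hB3c : (B.card : ℝ) / 2 ≤ B3.card := by
    have : B1.card ≤ B3.card + X.card := by
      have := Finset.le_card_sdiff X B1
      rw [← hB3] at this
      omega
    have : (B1.card : ℝ) ≤ B3.card + X.card := by exact_mod_cast this
    linarith
  set F := X.powerset.filter fun Y => (Y.card : ℝ) ≤ γ * X.card with hF
  have hFc := small_subsets X z K γ hz hz1 hγ hK
  rw [← hF] at hFc
  have hFne : F.Nonempty := ⟨∅, by simp [hF]; positivity⟩
  have hmaps : ∀ b ∈ B3, tr b ∈ F := by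
    intro b hb
    rw [hB3, Finset.mem_sdiff, hB1, Finset.mem_filter] at hb
    rw [hF, Finset.mem_filter, Finset.mem_powerset]
    exact ⟨Finset.filter_subset _ _, hb.1.2⟩
  have hFpos : (0:ℝ) < F.card := by exact_mod_cast Finset.card_pos.mpr hFne
  obtain ⟨Y, hY, hYc⟩ := Finset.exists_le_card_fiber_of_nsmul_le_card_of_maps_to (M := ℝ)
    (b := (B3.card : ℝ) / F.card) hmaps hFne (by
      rw [nsmul_eq_mul]; field_simp; exact le_rfl)
  rw [hF, Finset.mem_filter, Finset.mem_powerset] at hY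
  refine ⟨Y, hY.1, hY.2, B3.filter fun b => tr b = Y, ?_, ?_, ?_, ?_⟩
  · exact (Finset.filter_subset _ _).trans (Finset.sdiff_subset.trans (Finset.filter_subset _ _))
  · exact Finset.disjoint_of_subset_left (Finset.filter_subset _ _) Finset.sdiff_disjoint
  · intro w hw x hx hadj
    rw [Finset.mem_filter] at hw
    rw [← hw.2]
    simp [htr, hx, hadj]
  · rw [div_le_iff₀ hFpos] at hYc
    have h0 : (0:ℝ) ≤ ((B3.filter fun b => tr b = Y).card : ℝ) := by positivity
    have := mul_le_mul_of_nonneg_left hFc h0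
    nlinarith

lemma step_lemma {V : Type} (G : SimpleGraph V) (S A B : Finset V) (z K γ m u : ℝ) (hz : 0 < z)
    (hz1 : z ≤ 1) (hγ : 0 < γ) (hγ1 : γ ≤ 1 / 2) (hAS : A ⊆ S) (hBS : B ⊆ S)
    (hK : ∀ T : Finset V, Gᶜ.IsClique (T : Set V) → (T.card : ℝ) ≤ K)
    (hKB : 4 * K ≤ B.card) (hBpos : (0:ℝ) < B.card) (hA : 2 * m ≤ A.card)
    (hB : 2 * ((1 + z) ^ K * z ^ (-(γ * K))) * m ≤ B.card)
    (hd : (((A ×ˢ B).filter fun ab => G.Adj ab.1 ab.2).card : ℝ) ≤ γ / 8 * (A.card * B.card))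
    (hrec : ∀ S' ⊆ S, m ≤ (S'.card : ℝ) →
      ∃ T ⊆ S', Gᶜ.IsClique (T : Set V) ∧ u ≤ (T.card : ℝ)) :
    ∃ T ⊆ S, Gᶜ.IsClique (T : Set V) ∧ 3 / 2 * u ≤ (T.card : ℝ) := by
  have hcl := clean_side G A B (γ / 8) (by positivity) hBpos hd
  obtain ⟨X, hXA, hXcl, hXu⟩ := hrec _ ((Finset.filter_subset _ _).trans hAS)
    (show m ≤ _ by linarith)
  obtain ⟨Y, hYX, hYc, W, hWB, hWX, htr, hWc⟩ := trace_lemma G X B z K γ hz hz1 hγ (hK X hXcl) hKB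
    (fun a ha => (Finset.mem_filter.mp (hXA ha)).2)
  have hQ : 0 < 2 * ((1 + z) ^ K * z ^ (-(γ * K))) := by positivity
  obtain ⟨X', hX'W, hX'cl, hX'u⟩ := hrec W (hWB.trans hBS)
    (le_of_mul_le_mul_left (hB.trans hWc) hQ)
  have hdisj : Disjoint (X \ Y) X' := by
    apply Finset.disjoint_of_subset_left Finset.sdiff_subset
    exact (Finset.disjoint_of_subset_left hX'W hWX).symm
  refine ⟨(X \ Y) ∪ X', ?_, ?_, ?_⟩
  · apply Finset.union_subset
    · exact Finset.sdiff_subset.trans (hXA.trans ((Finset.filter_subset _ _).trans hAS))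
    · exact hX'W.trans (hWB.trans hBS)
  · have key : ∀ x ∈ X \ Y, ∀ w ∈ X', Gᶜ.Adj x w := by
      intro x hx w hw
      rw [SimpleGraph.compl_adj]
      refine ⟨fun h => Finset.disjoint_left.mp hdisj hx (h ▸ hw), fun h => ?_⟩
      rw [Finset.mem_sdiff] at hx
      exact hx.2 (htr w (hX'W hw) x hx.1 h)
    intro p hp q hq hpq
    rw [Finset.mem_coe, Finset.mem_union] at hp hq
    rcases hp with hp | hp <;> rcases hq with hq | hq
    · exact hXcl (Finset.mem_sdiff.mp hp).1 (Finset.mem_sdiff.mp hq).1 hpq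
    · exact key p hp q hq
    · exact (key q hq p hp).symm
    · exact hX'cl hp hq hpq
  · rw [Finset.card_union_of_disjoint hdisj, Finset.card_sdiff_of_subset hYX,
      Nat.cast_add, Nat.cast_sub (Finset.card_le_card hYX)]
    have : (0:ℝ) ≤ X.card := by positivity
    nlinarith

lemma choose_params (c τ : ℝ) (hc : 0 < c) (hτ : 0 < τ) :
    ∃ z γ : ℝ, 0 < z ∧ z ≤ 1 ∧ 0 < γ ∧ γ ≤ 1 / 2 ∧
      (1 + z) ^ c * z ^ (-(γ * c)) ≤ 2 ^ τ := by
  have hl2 : 0 < Real.log 2 := Real.log_pos (by norm_num)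
  set z := min (1/2) (τ * Real.log 2 / (2 * c)) with hzdef
  have hz : 0 < z := lt_min (by norm_num) (by positivity)
  have hz1 : z ≤ 1/2 := min_le_left _ _
  have hz2 : z ≤ τ * Real.log 2 / (2 * c) := min_le_right _ _
  have hlz : 0 < - Real.log z := by
    have := Real.log_neg hz (by linarith)
    linarith
  set γ := min (1/2) (τ * Real.log 2 / (2 * c * (- Real.log z))) with hγdef
  have hγ : 0 < γ := lt_min (by norm_num) (by positivity)
  have hγ2 : γ ≤ τ * Real.log 2 / (2 * c * (- Real.log z)) := min_le_right _ _
  refine ⟨z, γ, hz, by linarith, hγ, min_le_left _ _, ?_⟩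
  rw [← Real.log_le_log_iff (by positivity) (by positivity),
    Real.log_mul (by positivity) (by positivity), Real.log_rpow (by positivity),
    Real.log_rpow hz, Real.log_rpow (by norm_num)]
  have h1 : Real.log (1 + z) ≤ z := by
    have := Real.log_le_sub_one_of_pos (show 0 < 1 + z by linarith)
    linarith
  rw [le_div_iff₀ (by positivity)] at hz2 hγ2
  nlinarith

lemma base_lemma {V : Type} (H : SimpleGraph V) (S : Finset V) (c x a L ν : ℝ) (hx : 0 < x)
    (hc : 0 < c) (ha : 0 < a) (hL : 0 < L) (hν : 0 < ν) (hLn : (2:ℝ) ^ L = ν)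
    (hxc : (1 + x) = 2 ^ (1 / (4 * c))) (hxa : (1 + 1 / x) = 2 ^ (1 / (4 * a)))
    (hbig : (1 + 1 / x) * (1 + x) ≤ ν ^ ((1:ℝ) / 4))
    (hS : ν ^ ((3:ℝ) / 4) ≤ (S.card : ℝ))
    (hno : ¬ ∃ T : Finset V, T.card = ⌈c * L⌉₊ ∧ Hᶜ.IsClique (T : Set V)) :
    ∃ T ⊆ S, H.IsClique (T : Set V) ∧ a * L ≤ (T.card : ℝ) := by
  have hxi : 0 < 1 / x := by positivity
  have h1 : (1 + 1 / x) ^ ⌈a * L⌉₊ ≤ (1 + 1 / x) * ν ^ ((1:ℝ) / 4) := by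
    have e : (1 + 1 / x) * ν ^ ((1:ℝ) / 4) = (1 + 1 / x) ^ (a * L + 1) := by
      rw [Real.rpow_add (by positivity), Real.rpow_one, mul_comm, ← hLn]
      congr 1
      rw [hxa, ← Real.rpow_mul (by norm_num), ← Real.rpow_mul (by norm_num)]
      congr 1
      field_simp
    rw [e, ← Real.rpow_natCast]
    exact Real.rpow_le_rpow_of_exponent_le (by linarith) (Nat.ceil_lt_add_one (by positivity)).le
  have h2 : (1 + x) ^ ⌈c * L⌉₊ ≤ (1 + x) * ν ^ ((1:ℝ) / 4) := by
    have e : (1 + x) * ν ^ ((1:ℝ) / 4) = (1 + x) ^ (c * L + 1) := by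
      rw [Real.rpow_add (by positivity), Real.rpow_one, mul_comm, ← hLn]
      congr 1
      rw [hxc, ← Real.rpow_mul (by norm_num), ← Real.rpow_mul (by norm_num)]
      congr 1
      field_simp
    rw [e, ← Real.rpow_natCast]
    exact Real.rpow_le_rpow_of_exponent_le (by linarith) (Nat.ceil_lt_add_one (by positivity)).le
  have h34 : ν ^ ((3:ℝ) / 4) = ν ^ ((1:ℝ) / 4) * (ν ^ ((1:ℝ) / 4) * ν ^ ((1:ℝ) / 4)) := by
    rw [← Real.rpow_add hν, ← Real.rpow_add hν]
    norm_num
  have h3 : (1 + 1 / x) ^ ⌈a * L⌉₊ * (1 + x) ^ ⌈c * L⌉₊ - 1 ≤ (S.card : ℝ) := by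
    have h4 := mul_le_mul h1 h2 (by positivity) (by positivity)
    have h5 := mul_le_mul_of_nonneg_right hbig
      (show 0 ≤ ν ^ ((1:ℝ) / 4) * ν ^ ((1:ℝ) / 4) by positivity)
    nlinarith
  rcases weighted_ramsey H x hx _ _ _ rfl S h3 with ⟨T, hT, hcl, hTc⟩ | ⟨T, hT, hcl, hTc⟩
  · exact ⟨T, hT, hcl, hTc ▸ Nat.le_ceil _⟩
  · exact absurd ⟨T, hTc, hcl⟩ hno

lemma clique_card_le {V : Type} (H : SimpleGraph V) (κ : ℝ)
    (hno : ¬ ∃ T : Finset V, T.card = ⌈κ⌉₊ ∧ H.IsClique (T : Set V)) (T : Finset V)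
    (hT : H.IsClique (T : Set V)) : (T.card : ℝ) < κ := by
  by_contra hcon
  push Not at hcon
  obtain ⟨T', hT', hc'⟩ := Finset.exists_subset_card_eq (Nat.ceil_le.mpr hcon)
  exact hno ⟨T', hc', hT.subset (by exact_mod_cast hT')⟩

lemma non_adj_count {V : Type} (G : SimpleGraph V) (A B : Finset V) :
    (((A ×ˢ B).filter fun ab => Gᶜ.Adj ab.1 ab.2).card : ℝ) ≤
      (A.card : ℝ) * B.card - ((A ×ˢ B).filter fun ab => G.Adj ab.1 ab.2).card := by
  have h1 : ((A ×ˢ B).filter fun ab => Gᶜ.Adj ab.1 ab.2).card ≤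
      ((A ×ˢ B).filter fun ab => ¬ G.Adj ab.1 ab.2).card := by
    apply Finset.card_le_card
    intro p hp
    simp only [Finset.mem_filter, SimpleGraph.compl_adj] at hp ⊢
    exact ⟨hp.1, hp.2.2⟩
  have h2 : ((A ×ˢ B).filter fun ab => G.Adj ab.1 ab.2).card +
      ((A ×ˢ B).filter fun ab => ¬ G.Adj ab.1 ab.2).card = A.card * B.card := by
    rw [Finset.card_filter_add_card_filter_not, Finset.card_product]
  have h1' : (((A ×ˢ B).filter fun ab => Gᶜ.Adj ab.1 ab.2).card : ℝ) ≤
      ((A ×ˢ B).filter fun ab => ¬ G.Adj ab.1 ab.2).card := by exact_mod_cast h1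
  have h2' : (((A ×ˢ B).filter fun ab => G.Adj ab.1 ab.2).card : ℝ) +
      ((A ×ˢ B).filter fun ab => ¬ G.Adj ab.1 ab.2).card = A.card * B.card := by exact_mod_cast h2
  linarith

lemma sparse_of_density {V : Type} (G : SimpleGraph V) (A B : Finset V) (δ : ℝ)
    (hA : (0:ℝ) < A.card) (hB : (0:ℝ) < B.card) (h : density G A B < δ) :
    (((A ×ˢ B).filter fun ab => G.Adj ab.1 ab.2).card : ℝ) ≤ δ * (A.card * B.card) := by
  rw [density, div_lt_iff₀ (mul_pos hA hB)] at h
  exact h.le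

lemma compl_sparse_of_density {V : Type} (G : SimpleGraph V) (A B : Finset V) (δ : ℝ)
    (hA : (0:ℝ) < A.card) (hB : (0:ℝ) < B.card) (h : 1 - δ < density G A B) :
    (((A ×ˢ B).filter fun ab => Gᶜ.Adj ab.1 ab.2).card : ℝ) ≤ δ * (A.card * B.card) := by
  rw [density, lt_div_iff₀ (mul_pos hA hB)] at h
  have hcnt := non_adj_count G A B
  linarith

set_option maxHeartbeats 2000000 in
/-- (Prömel–Rödl.) Fix `c > 0`. There are `β, δ > 0` such that every
sufficiently large `c`-Ramsey graph `G` on `n` vertices contains `S ⊆ V(G)` with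
`|S| ≥ n^(3/4)` such that for all `A, B ⊆ S` with `|A|, |B| ≥ |S|^(1−β)` one has
`δ ≤ d(A,B) ≤ 1 − δ`. -/
theorem ramsey_graph_dense_subset (c : ℝ) (hc : 0 < c) :
    ∃ β : ℝ, 0 < β ∧ ∃ δ : ℝ, 0 < δ ∧ ∃ N : ℕ, ∀ n : ℕ, N ≤ n →
      ∀ G : SimpleGraph (Fin n), IsCRamsey c G →
        ∃ S : Finset (Fin n), (n : ℝ) ^ ((3 : ℝ) / 4) ≤ (S.card : ℝ) ∧
          ∀ A B : Finset (Fin n), A ⊆ S → B ⊆ S →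
            (S.card : ℝ) ^ ((1 : ℝ) - β) ≤ (A.card : ℝ) →
            (S.card : ℝ) ^ ((1 : ℝ) - β) ≤ (B.card : ℝ) →
            δ ≤ density G A B ∧ density G A B ≤ 1 - δ := by
  have hx : 0 < (2:ℝ) ^ (1 / (4 * c)) - 1 := by
    have := Real.one_lt_rpow (show (1:ℝ) < 2 by norm_num) (show 0 < 1 / (4 * c) by positivity)
    linarith
  set x : ℝ := (2:ℝ) ^ (1 / (4 * c)) - 1 with hxdef
  have hxc : 1 + x = 2 ^ (1 / (4 * c)) := by rw [hxdef]; ring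
  have hxi : 0 < 1 / x := by positivity
  have hl : 0 < Real.logb 2 (1 + 1 / x) := Real.logb_pos (by norm_num) (by linarith)
  set a : ℝ := 1 / (4 * Real.logb 2 (1 + 1 / x)) with hadef
  have ha : 0 < a := by positivity
  have hxa : 1 + 1 / x = 2 ^ (1 / (4 * a)) := by
    have : 1 / (4 * a) = Real.logb 2 (1 + 1 / x) := by rw [hadef]; field_simp
    rw [this, Real.rpow_logb (by norm_num) (by norm_num) (by positivity)]
  obtain ⟨r, hr1, hr⟩ : ∃ r : ℕ, 1 ≤ r ∧ c ≤ a * (3 / 2) ^ r := by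
    obtain ⟨r, hr⟩ := pow_unbounded_of_one_lt (c / a) (show (1:ℝ) < 3 / 2 by norm_num)
    refine ⟨r + 1, by omega, ?_⟩
    rw [div_lt_iff₀ ha] at hr
    have : (0:ℝ) < (3/2)^r := by positivity
    rw [pow_succ]
    nlinarith
  have hr1' : (1:ℝ) ≤ r := by exact_mod_cast hr1
  set σ : ℝ := 1 / (8 * r) with hσdef
  have hσ : 0 < σ := by positivity
  have hσr : σ * (2 * r) = 1 / 4 := by rw [hσdef]; field_simp; norm_num
  obtain ⟨z, γ, hz, hz1, hγ, hγ1, hparam⟩ := choose_params c (σ / 4) hc (by positivity)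
  have hcast : Filter.Tendsto (fun n : ℕ => (n : ℝ)) Filter.atTop Filter.atTop :=
    tendsto_natCast_atTop_atTop
  have hlog : ∀ᶠ y : ℝ in Filter.atTop, 4 * (c * Real.logb 2 y) ≤ y ^ ((3:ℝ) / 4) := by
    have h := (isLittleO_log_rpow_atTop (show (0:ℝ) < 3 / 4 by norm_num)).def
      (show 0 < Real.log 2 / (4 * c) by
        have := Real.log_pos (show (1:ℝ) < 2 by norm_num); positivity)
    filter_upwards [h, Filter.eventually_ge_atTop (1:ℝ)] with y hy hy1
    rw [Real.norm_of_nonneg (Real.log_nonneg hy1), Real.norm_of_nonneg (by positivity)] at hy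
    have hl2 : 0 < Real.log 2 := Real.log_pos (by norm_num)
    rw [Real.logb, show 4 * (c * (Real.log y / Real.log 2)) = Real.log y / (Real.log 2 / (4 * c)) by
      field_simp, div_le_iff₀ (by positivity)]
    linarith
  have hev : ∀ᶠ n : ℕ in Filter.atTop, (2:ℝ) ≤ n ∧ (1 + 1 / x) * (1 + x) ≤ (n:ℝ) ^ ((1:ℝ) / 4) ∧
      4 ≤ (n:ℝ) ^ (σ / 4) ∧ 4 * (c * Real.logb 2 n) ≤ (n:ℝ) ^ ((3:ℝ) / 4) := by
    have e1 := hcast.eventually (Filter.eventually_ge_atTop (2:ℝ))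
    have e2 := hcast.eventually ((tendsto_rpow_atTop (show (0:ℝ) < 1 / 4 by norm_num)).eventually
      (Filter.eventually_ge_atTop ((1 + 1 / x) * (1 + x))))
    have e3 := hcast.eventually ((tendsto_rpow_atTop (show 0 < σ / 4 by positivity)).eventually
      (Filter.eventually_ge_atTop 4))
    have e4 := hcast.eventually hlog
    filter_upwards [e1, e2, e3, e4] with n h1 h2 h3 h4
    exact ⟨h1, h2, h3, h4⟩
  obtain ⟨N, hN⟩ := Filter.eventually_atTop.mp hev
  refine ⟨σ / 4, by positivity, γ / 8, by positivity, N, ?_⟩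
  intro n hn G hG
  obtain ⟨hn2, hbig, h4, hlogn⟩ := hN n hn
  by_contra hcon
  push Not at hcon
  set L := Real.logb 2 n with hLdef
  have hn0 : (0:ℝ) < n := by linarith
  have hn1 : (1:ℝ) ≤ n := by linarith
  have hL : 0 < L := Real.logb_pos (by norm_num) (by linarith)
  have hLn : (2:ℝ) ^ L = n := Real.rpow_logb (by norm_num) (by norm_num) hn0
  have hnoG : ¬ ∃ T : Finset (Fin n), T.card = ⌈c * L⌉₊ ∧ G.IsClique (T : Set (Fin n)) :=
    fun ⟨T, h1, h2⟩ => hG ⟨T, h1, Or.inl h2⟩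
  have hnoI : ¬ ∃ T : Finset (Fin n), T.card = ⌈c * L⌉₊ ∧ Gᶜ.IsClique (T : Set (Fin n)) :=
    fun ⟨T, h1, h2⟩ => hG ⟨T, h1, Or.inr h2⟩
  have hQ : (1 + z) ^ (c * L) * z ^ (-(γ * (c * L))) ≤ (n:ℝ) ^ (σ / 4) := by
    have e1 : (1 + z) ^ (c * L) * z ^ (-(γ * (c * L))) = ((1 + z) ^ c * z ^ (-(γ * c))) ^ L := by
      rw [Real.mul_rpow (by positivity) (by positivity), ← Real.rpow_mul (by positivity),
        ← Real.rpow_mul hz.le]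
      congr 2
      ring
    have e2 : (n:ℝ) ^ (σ / 4) = ((2:ℝ) ^ (σ / 4)) ^ L := by
      rw [← hLn, ← Real.rpow_mul (by norm_num), ← Real.rpow_mul (by norm_num), mul_comm]
    rw [e1, e2]
    exact Real.rpow_le_rpow (by positivity) hparam hL.le
  have main : ∀ d : ℕ, d ≤ 2 * r → ∀ p q : ℕ, p + q = d → ∀ S : Finset (Fin n),
      (n:ℝ) ^ ((3:ℝ) / 4 + d * σ) ≤ (S.card : ℝ) →
      (∃ T ⊆ S, Gᶜ.IsClique (T : Set (Fin n)) ∧ a * (3 / 2) ^ p * L ≤ (T.card : ℝ)) ∨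
      (∃ T ⊆ S, G.IsClique (T : Set (Fin n)) ∧ a * (3 / 2) ^ q * L ≤ (T.card : ℝ)) := by
    intro d
    induction d with
    | zero =>
      intro _ p q hpq S hS
      have hq : q = 0 := by omega
      subst hq
      right
      have := base_lemma G S c x a L n hx hc ha hL hn0 hLn hxc hxa hbig (by simpa using hS) hnoI
      simpa using this
    | succ d ih =>
      intro hd p q hpq S hS
      have hS34 : (n:ℝ) ^ ((3:ℝ) / 4) ≤ (S.card : ℝ) := by
        refine le_trans (Real.rpow_le_rpow_of_exponent_le hn1 ?_) hS
        have : 0 ≤ ((d + 1 : ℕ) : ℝ) * σ := by positivity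
        linarith
      rcases q with _ | q
      · right
        have := base_lemma G S c x a L n hx hc ha hL hn0 hLn hxc hxa hbig hS34 hnoI
        simpa using this
      rcases p with _ | p
      · left
        have := base_lemma Gᶜ S c x a L n hx hc ha hL hn0 hLn hxc hxa hbig hS34
          (by rw [compl_compl]; exact hnoG)
        simpa using this
      obtain ⟨A, B, hAS, hBS, hA, hB, hAB⟩ := hcon S hS34
      set θ : ℝ := (3:ℝ) / 4 + d * σ with hθ
      have hdr : ((d:ℝ) + 1) * σ ≤ 1 / 4 := by
        have : (d:ℝ) + 1 ≤ 2 * r := by exact_mod_cast hd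
        nlinarith
      have hθ34 : 3 / 4 ≤ θ := by
        have : 0 ≤ (d:ℝ) * σ := by positivity
        linarith
      have hσ1 : σ ≤ 1 / 4 := by
        have : 0 ≤ (d:ℝ) * σ := by positivity
        nlinarith
      have hbigset : (n:ℝ) ^ (θ + 3 * (σ / 4)) ≤ (S.card : ℝ) ^ (1 - σ / 4) := by
        calc (n:ℝ) ^ (θ + 3 * (σ / 4)) ≤ (n:ℝ) ^ (((3:ℝ) / 4 + ((d + 1 : ℕ) : ℝ) * σ) * (1 - σ / 4)) := by
              apply Real.rpow_le_rpow_of_exponent_le hn1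
              push_cast
              nlinarith
          _ = ((n:ℝ) ^ ((3:ℝ) / 4 + ((d + 1 : ℕ) : ℝ) * σ)) ^ (1 - σ / 4) := Real.rpow_mul hn0.le _ _
          _ ≤ _ := Real.rpow_le_rpow (by positivity) hS (by linarith)
      have hA' := hbigset.trans hA
      have hB' := hbigset.trans hB
      have hexp : (n:ℝ) ^ (θ + 3 * (σ / 4)) =
          (n:ℝ) ^ θ * ((n:ℝ) ^ (σ / 4) * ((n:ℝ) ^ (σ / 4) * (n:ℝ) ^ (σ / 4))) := by
        rw [← Real.rpow_add hn0, ← Real.rpow_add hn0, ← Real.rpow_add hn0]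
        congr 1
        ring
      have hm : 0 < (n:ℝ) ^ θ := by positivity
      set m := (n:ℝ) ^ θ with hmdef
      set g := (n:ℝ) ^ (σ / 4) with hgdef
      have hm34 : (n:ℝ) ^ ((3:ℝ) / 4) ≤ m := Real.rpow_le_rpow_of_exponent_le hn1 hθ34
      have hgg : 4 * g ≤ g * g := by nlinarith
      have hmg : 2 * g * m ≤ (n:ℝ) ^ (θ + 3 * (σ / 4)) := by
        rw [hexp]
        have : 2 * g ≤ g * (g * g) := by nlinarith
        nlinarith
      have h2m : 2 * m ≤ 2 * g * m := by nlinarith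
      have hmB : m ≤ B.card := by linarith
      have hBpos : (0:ℝ) < B.card := by linarith
      have hApos : (0:ℝ) < A.card := by linarith
      have hKB : 4 * (c * L) ≤ B.card := by linarith
      have hQB : 2 * ((1 + z) ^ (c * L) * z ^ (-(γ * (c * L)))) * m ≤ B.card := by
        refine le_trans ?_ (hmg.trans hB')
        gcongr
      by_cases hlow : γ / 8 ≤ density G A B
      · have hden := hAB hlow
        have hd' := compl_sparse_of_density G A B (γ / 8) hApos hBpos hden
        by_cases hex : ∃ T ⊆ S, Gᶜ.IsClique (T : Set (Fin n)) ∧ a * (3 / 2) ^ (p + 1) * L ≤ (T.card : ℝ)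
        · exact Or.inl hex
        right
        have := step_lemma Gᶜ S A B z (c * L) γ m (a * (3 / 2) ^ q * L) hz hz1 hγ hγ1 hAS hBS
          (fun T hT => (clique_card_le G (c * L) hnoG T (by rwa [compl_compl] at hT)).le)
          hKB hBpos (by linarith) hQB (by convert hd') (by
            intro S' hS' hm'
            rw [compl_compl]
            rcases ih (by omega) (p + 1) q (by omega) S' hm' with ⟨T, hT, h1, h2⟩ | h
            · exact absurd ⟨T, hT.trans hS', h1, h2⟩ hex
            · exact h)
        rw [compl_compl] at this
        obtain ⟨T, hT, h1, h2⟩ := this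
        exact ⟨T, hT, h1, by rw [pow_succ]; linarith⟩
      · have hd' := sparse_of_density G A B (γ / 8) hApos hBpos (not_le.mp hlow)
        by_cases hex : ∃ T ⊆ S, G.IsClique (T : Set (Fin n)) ∧ a * (3 / 2) ^ (q + 1) * L ≤ (T.card : ℝ)
        · exact Or.inr hex
        left
        obtain ⟨T, hT, h1, h2⟩ := step_lemma G S A B z (c * L) γ m (a * (3 / 2) ^ p * L)
          hz hz1 hγ hγ1 hAS hBS
          (fun T hT => (clique_card_le Gᶜ (c * L) hnoI T hT).le)
          hKB hBpos (by linarith) hQB hd' (by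
            intro S' hS' hm'
            rcases ih (by omega) p (q + 1) (by omega) S' hm' with h | ⟨T, hT, h1, h2⟩
            · exact h
            · exact absurd ⟨T, hT.trans hS', h1, h2⟩ hex)
        exact ⟨T, hT, h1, by rw [pow_succ]; linarith⟩
  have hfin := main (2 * r) le_rfl r r (by omega) Finset.univ (by
    rw [Finset.card_univ, Fintype.card_fin]
    have : (3:ℝ) / 4 + ((2 * r : ℕ) : ℝ) * σ = 1 := by push_cast; linarith
    rw [this, Real.rpow_one])
  have hcr : c * L ≤ a * (3 / 2) ^ r * L := by gcongr
  rcases hfin with ⟨T, -, h1, h2⟩ | ⟨T, -, h1, h2⟩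
  · have := clique_card_le Gᶜ (c * L) hnoI T h1
    linarith
  · have := clique_card_le G (c * L) hnoG T h1
    linarith
end

section
/- Let G be a graph, S ⊆ V(G) a finite set with m = |S|, and β, δ > 0 be such that d(A,B) ≥ δ for all A, B ⊆ S with |A|, |B| ≥ m^{1−β}. Let r ≥ 1 and let X, Y₁, Y₂, …, Y_r ⊆ S satisfy |X| ≥ r·m^{1−β} and |Y_i| ≥ m^{1−β} for each i. Then there exists a vertex v ∈ X such that d(v, Y_i) ≥ δ for every i = 1, …, r. -/
open Classical
/-- Let `S` be a finite vertex set with `m = |S|` in a graph `G`, and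
`β, δ > 0` be such that `d(A,B) ≥ δ` whenever `A, B ⊆ S` have size at least `m^(1−β)`.
If `X, Y₁, …, Y_r ⊆ S` with `r ≥ 1`, `|X| ≥ r·m^(1−β)` and each `|Y_i| ≥ m^(1−β)`, then
some `v ∈ X` satisfies `d(v, Y_i) ≥ δ` for every `i`. -/
theorem dense_extension {α : Type} (G : SimpleGraph α) (S : Finset α) (β δ : ℝ)
    (hβ : 0 < β) (hδ : 0 < δ)
    (hdense : ∀ A B : Finset α, A ⊆ S → B ⊆ S →
      (S.card : ℝ) ^ ((1 : ℝ) - β) ≤ (A.card : ℝ) →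
      (S.card : ℝ) ^ ((1 : ℝ) - β) ≤ (B.card : ℝ) → δ ≤ density G A B)
    (r : ℕ) (hr : 1 ≤ r) (X : Finset α) (Y : Fin r → Finset α)
    (hX : X ⊆ S) (hY : ∀ i, Y i ⊆ S)
    (hXcard : (r : ℝ) * (S.card : ℝ) ^ ((1 : ℝ) - β) ≤ (X.card : ℝ))
    (hYcard : ∀ i, (S.card : ℝ) ^ ((1 : ℝ) - β) ≤ ((Y i).card : ℝ)) :
    ∃ v ∈ X, ∀ i, δ ≤ density G {v} (Y i) := by
  have ht : 0 < (S.card : ℝ) ^ ((1 : ℝ) - β) := by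
    by_contra h
    have h1 := hdense ∅ ∅ (Finset.empty_subset _) (Finset.empty_subset _)
      (by simpa using h) (by simpa using h)
    simp [density] at h1
    linarith
  generalize (S.card : ℝ) ^ ((1 : ℝ) - β) = t at *
  by_contra hcon
  push Not at hcon
  let Bad : Fin r → Finset α := fun i => X.filter fun v => density G {v} (Y i) < δ
  have hcover : X ⊆ Finset.univ.biUnion Bad := by
    intro v hv
    obtain ⟨i, hi⟩ := hcon v hv
    exact Finset.mem_biUnion.2 ⟨i, Finset.mem_univ _, Finset.mem_filter.2 ⟨hv, hi⟩⟩
  have hcard : X.card ≤ ∑ i, (Bad i).card :=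
    (Finset.card_le_card hcover).trans Finset.card_biUnion_le
  obtain ⟨i, hi⟩ : ∃ i, t ≤ ((Bad i).card : ℝ) := by
    by_contra hall
    push Not at hall
    have : Nonempty (Fin r) := ⟨⟨0, hr⟩⟩
    have h2 : ∑ i, ((Bad i).card : ℝ) < ∑ _i : Fin r, t :=
      Finset.sum_lt_sum_of_nonempty Finset.univ_nonempty fun i _ => hall i
    have h3 : (X.card : ℝ) ≤ ∑ i, ((Bad i).card : ℝ) := by exact_mod_cast hcard
    simp at h2
    linarith
  have hd := hdense (Bad i) (Y i) ((Finset.filter_subset _ _).trans hX) (hY i) hi (hYcard i)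
  have hA : (0 : ℝ) < ((Bad i).card : ℝ) := ht.trans_le hi
  have hB : (0 : ℝ) < ((Y i).card : ℝ) := ht.trans_le (hYcard i)
  have hne : (Bad i).Nonempty := Finset.card_pos.1 (by exact_mod_cast hA)
  have key : ∀ A : Finset α,
      ((((A ×ˢ Y i).filter fun ab => G.Adj ab.1 ab.2).card : ℕ) : ℝ)
        = ∑ v ∈ A, (∑ b ∈ Y i, if G.Adj v b then (1 : ℝ) else 0) := by
    intro A
    rw [Finset.card_filter, Finset.sum_product]
    push_cast
    rfl
  unfold density at hd
  rw [le_div_iff₀ (mul_pos hA hB), key] at hd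
  have hlt : ∑ v ∈ Bad i, (∑ b ∈ Y i, if G.Adj v b then (1 : ℝ) else 0)
      < ∑ _v ∈ Bad i, δ * ((Y i).card : ℝ) := by
    apply Finset.sum_lt_sum_of_nonempty hne
    intro v hv
    have h4 := (Finset.mem_filter.1 hv).2
    unfold density at h4
    rw [key, Finset.sum_singleton, Finset.card_singleton, Nat.cast_one, one_mul,
      div_lt_iff₀ hB] at h4
    exact h4
  rw [Finset.sum_const, nsmul_eq_mul] at hlt
  linarith [mul_left_comm δ ((Bad i).card : ℝ) ((Y i).card : ℝ)]
end
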